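/- Let B ⊆ ℝ be a countable set with 0 ∉ B. Then the set S := {(g, w) ∈ SL(2,ℝ) × ℝ² : closure{(gm+w)₁·(gm+w)₂ : m ∈ ℤ²} ∩ B = ∅} is thick; that is, for every open set U ⊆ M₂(ℝ) × ℝ² with U ∩ (SL(2,ℝ) × ℝ²) ≠ ∅, the Hausdorff dimension of S ∩ U equals 5. -/

import Mathlib

/-- The values of the form `Q₀(y) = y₁y₂` on the affine lattice `gℤ² + w`. -/
def affValSet (g : Fin 2 → Fin 2 → ℝ) (w : Fin 2 → ℝ) : Set ℝ :=
  {v : ℝ | ∃ m₁ m₂ : ℤ,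
    v = (g 0 0 * m₁ + g 0 1 * m₂ + w 0) * (g 1 0 * m₁ + g 1 1 * m₂ + w 1)}

/-- Membership of `g` (as a `2×2` array) in `SL(2,ℝ)`. -/
def isSL2 (g : Fin 2 → Fin 2 → ℝ) : Prop :=
  g 0 0 * g 1 1 - g 0 1 * g 1 0 = 1

open MeasureTheory Measure Filter Topology in
/-- If all the slices of `E` over a set of positive measure in `ℝ^n` have dimension at
least `1`, then `E` has dimension at least `n + 1`. -/
theorem le_dimH_of_slices {n : ℕ} (E : Set ((Fin n → ℝ) × ℝ)) (V : Set (Fin n → ℝ))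
    (hV : volume V ≠ 0) (hE : ∀ t ∈ V, 1 ≤ dimH {σ : ℝ | (t, σ) ∈ E}) :
    (n : ENNReal) + 1 ≤ dimH E := by
  by_contra hlt
  push Not at hlt
  obtain ⟨θ, hθ1, hθE⟩ : ∃ θ : NNReal, θ < 1 ∧ dimH E < ((n + θ : NNReal) : ENNReal) := by
    obtain ⟨x, hx1, hx2⟩ := ENNReal.lt_iff_exists_nnreal_btwn.1 hlt
    have hx2' : x < n + 1 := by exact_mod_cast hx2
    refine ⟨x - n, ?_, hx1.trans_le ?_⟩
    · rcases le_total (n : NNReal) x with h | h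
      · rw [← NNReal.coe_lt_coe, NNReal.coe_sub h]
        rw [← NNReal.coe_lt_coe] at hx2'
        push_cast at *
        linarith
      · rw [tsub_eq_zero_of_le h]; exact one_pos
    · exact_mod_cast le_add_tsub
  have hnull : μH[((n + θ : NNReal) : ℝ)] E = 0 := hausdorffMeasure_of_dimH_lt hθE
  have hcov : ∀ k : ℕ, ∃ u : ℕ → Set ((Fin n → ℝ) × ℝ), E ⊆ ⋃ i, u i ∧
      (∀ i, Metric.ediam (u i) ≤ (1 / 2) ^ k) ∧
      ∑' i, ⨆ _ : (u i).Nonempty, Metric.ediam (u i) ^ ((n + θ : NNReal) : ℝ) ≤ (1 / 2) ^ k := by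
    intro k
    by_contra hcon
    push Not at hcon
    have hpos : (0 : ENNReal) < (1 / 2) ^ k := by
      apply pos_iff_ne_zero.2
      apply pow_ne_zero
      simp
    have : ((1 : ENNReal) / 2) ^ k ≤ μH[((n + θ : NNReal) : ℝ)] E := by
      rw [hausdorffMeasure_apply]
      refine le_iSup₂_of_le ((1 / 2) ^ k) hpos ?_
      refine le_iInf fun u => le_iInf fun h1 => le_iInf fun h2 => (hcon u h1 h2).le
    rw [hnull] at this
    exact absurd hpos (not_lt.2 this)
  choose u hu1 hu2 hu3 using hcov
  -- the indicator of the shadow of a covering set, enlarged to a closed ball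
  have hball : ∀ k i, ∃ S : Set (Fin n → ℝ), MeasurableSet S ∧ Prod.fst '' u k i ⊆ S ∧
      volume S * (⨆ _ : (u k i).Nonempty, Metric.ediam (u k i) ^ (θ : ℝ)) ≤
        2 ^ n * ⨆ _ : (u k i).Nonempty, Metric.ediam (u k i) ^ ((n + θ : NNReal) : ℝ) := by
    intro k i
    by_cases hne : (u k i).Nonempty
    · obtain ⟨p, hp⟩ := hne
      have hfin : Metric.ediam (u k i) ≠ ⊤ :=
        ne_top_of_le_ne_top (ENNReal.pow_ne_top (by simp)) (hu2 k i)
      refine ⟨Metric.closedBall p.1 (Metric.ediam (u k i)).toReal, measurableSet_closedBall, ?_, ?_⟩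
      · rintro _ ⟨q, hq, rfl⟩
        rw [Metric.mem_closedBall]
        have h1 : dist q.1 p.1 ≤ dist q p := by
          rw [Prod.dist_eq]; exact le_max_left _ _
        refine h1.trans ?_
        rw [dist_edist]
        exact ENNReal.toReal_mono hfin (Metric.edist_le_ediam_of_mem hq hp)
      · have hne : (u k i).Nonempty := ⟨p, hp⟩
        rw [ciSup_pos hne, ciSup_pos hne, Real.volume_pi_closedBall _ ENNReal.toReal_nonneg, Fintype.card_fin,
          ENNReal.ofReal_pow (by positivity), ENNReal.ofReal_mul (by norm_num),
          ENNReal.ofReal_toReal hfin, mul_pow, mul_assoc]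
        push_cast
        rw [ENNReal.rpow_add_of_nonneg _ _ (by positivity) (by positivity), ENNReal.rpow_natCast]
        simp
    · exact ⟨∅, MeasurableSet.empty, by simp [Set.not_nonempty_iff_eq_empty.1 hne], by simp⟩
  choose S hSm hS hSv using hball
  let w : ℕ → ℕ → ENNReal := fun k i => ⨆ _ : (u k i).Nonempty, Metric.ediam (u k i) ^ (θ : ℝ)
  let f : ℕ → (Fin n → ℝ) → ENNReal := fun k t => ∑' i, (S k i).indicator (fun _ => w k i) t
  have hfm : ∀ k, Measurable (f k) := fun k =>
    Measurable.tsum fun i => measurable_const.indicator (hSm k i)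
  have hfk : ∀ k, ∫⁻ t, f k t ≤ 2 ^ n * (1 / 2) ^ k := by
    intro k
    rw [lintegral_tsum fun i => (measurable_const.indicator (hSm k i)).aemeasurable]
    calc ∑' i, ∫⁻ t, (S k i).indicator (fun _ => w k i) t
        = ∑' i, volume (S k i) * w k i := by
          congr 1; ext i; rw [lintegral_indicator_const (hSm k i), mul_comm]
      _ ≤ ∑' i, 2 ^ n * ⨆ _ : (u k i).Nonempty, Metric.ediam (u k i) ^ ((n + θ : NNReal) : ℝ) :=
          ENNReal.tsum_le_tsum fun i => hSv k i
      _ ≤ _ := by rw [ENNReal.tsum_mul_left]; gcongr; exact hu3 k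
  have hsum : ∫⁻ t, ∑' k, f k t ≠ ⊤ := by
    rw [lintegral_tsum fun k => (hfm k).aemeasurable]
    refine ne_top_of_le_ne_top ?_ (ENNReal.tsum_le_tsum hfk)
    rw [ENNReal.tsum_mul_left, ENNReal.tsum_geometric]
    apply ENNReal.mul_ne_top (by simp)
    simp
  have hae := ae_lt_top (Measurable.tsum fun k => hfm k) hsum
  obtain ⟨t, htV, ht⟩ : ∃ t ∈ V, ∑' k, f k t < ⊤ := by
    by_contra hcon
    push Not at hcon
    apply hV
    refine measure_mono_null (fun t htV => ?_) hae
    simp [top_le_iff.1 (hcon t htV)]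
  have htend := ENNReal.tendsto_cofinite_zero_of_tsum_ne_top ht.ne
  rw [Nat.cofinite_eq_atTop] at htend
  have hzero : μH[(θ : ℝ)] {σ : ℝ | (t, σ) ∈ E} = 0 := by
    let T : ∀ k : ℕ, {i : ℕ // t ∈ S k i ∧ (u k i).Nonempty} → Set ℝ := fun k i => {σ | (t, σ) ∈ u k i}
    have hT : ∀ k i, Metric.ediam (T k i) ≤ Metric.ediam (u k i) := by
      intro k i
      refine Metric.ediam_le fun x hx y hy => ?_
      calc edist x y = edist (t, x) (t, y) := by simp [Prod.edist_eq]
        _ ≤ _ := Metric.edist_le_ediam_of_mem hx hy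
    have hgeom : Tendsto (fun k : ℕ => ((1 : ENNReal) / 2) ^ k) atTop (𝓝 0) :=
      ENNReal.tendsto_pow_atTop_nhds_zero_of_lt_one (by simp)
    refine le_antisymm ?_ zero_le
    refine (hausdorffMeasure_le_liminf_tsum (θ : ℝ) _ _ hgeom T
      (Eventually.of_forall fun k i => (hT k i).trans (hu2 k i)) (Eventually.of_forall fun k σ hσ => ?_)).trans ?_
    · obtain ⟨i, hi⟩ := Set.mem_iUnion.1 (hu1 k hσ)
      exact Set.mem_iUnion.2 ⟨⟨i, hS k i ⟨_, hi, rfl⟩, ⟨_, hi⟩⟩, hi⟩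
    · rw [← htend.liminf_eq]
      refine liminf_le_liminf (Eventually.of_forall fun k => ?_)
      calc ∑' i, Metric.ediam (T k i) ^ (θ : ℝ)
          ≤ ∑' i : {i : ℕ // t ∈ S k i ∧ (u k i).Nonempty}, (S k i).indicator (fun _ => w k i) t := by
            refine ENNReal.tsum_le_tsum fun i => ?_
            rw [Set.indicator_of_mem i.2.1]
            simp only [w, ciSup_pos i.2.2]
            exact ENNReal.rpow_le_rpow (hT k i) θ.2
        _ ≤ f k t := ENNReal.tsum_comp_le_tsum_of_injective Subtype.val_injective _
  have hle : dimH {σ : ℝ | (t, σ) ∈ E} ≤ θ :=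
    dimH_le_of_hausdorffMeasure_ne_top (by rw [hzero]; simp)
  have := (hE t htV).trans hle
  exact absurd hθ1 (not_lt.2 (by exact_mod_cast this))

open MeasureTheory in
/-- A subset of `ℝ` obtained from a nested construction in which every interval of length `ℓ / R ^ n`
has `M` separated children of length `ℓ / R ^ (n + 1)` has dimension at least `log M / log R`. -/
theorem le_dimH_of_nested_intervals {R ℓ s₀ : ℝ} {M : ℕ} (hR : 1 < R) (hℓ : 0 < ℓ) (hM : 1 < M)
    (G : ℕ → ℝ → Prop) (h0 : G 0 s₀)
    (step : ∀ n x, G n x → ∃ c : Fin M → ℝ,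
      (∀ i, G (n + 1) (c i) ∧ x ≤ c i ∧ c i + ℓ / R ^ (n + 1) ≤ x + ℓ / R ^ n) ∧
      ∀ i i', i ≠ i' → 2 * (ℓ / R ^ (n + 1)) ≤ |c i - c i'|) :
    ENNReal.ofReal (Real.log M / Real.log R) ≤
      dimH {y : ℝ | ∀ n, ∃ x, G n x ∧ y ∈ Set.Icc x (x + ℓ / R ^ n)} := by
  have hR0 : 0 < R := by linarith
  choose! c hc hsep using step
  let X : (ℕ → Fin M) → ℕ → ℝ := fun ω n => Nat.rec s₀ (fun k x => c k x (ω k)) n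
  have hXs : ∀ ω n, X ω (n + 1) = c n (X ω n) (ω n) := fun ω n => rfl
  have hG : ∀ ω n, G n (X ω n) := by
    intro ω n
    induction n with
    | zero => exact h0
    | succ k ih => rw [hXs]; exact (hc k _ ih _).1
  have hmono : ∀ ω, Monotone (X ω) := fun ω => monotone_nat_of_le_succ fun n => by
    rw [hXs]; exact (hc n _ (hG ω n) _).2.1
  have hanti : ∀ ω, Antitone fun n => X ω n + ℓ / R ^ n := fun ω => antitone_nat_of_succ_le fun n => by
    simp only [hXs]; exact (hc n _ (hG ω n) _).2.2
  have hle : ∀ ω n m, X ω m ≤ X ω n + ℓ / R ^ n := by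
    intro ω n m
    have h1 := hmono ω (le_max_right n m)
    have h2 := hanti ω (le_max_left n m)
    have h3 : 0 < ℓ / R ^ (max n m) := by positivity
    simp only at h2
    linarith
  let pt : (ℕ → Fin M) → ℝ := fun ω => ⨆ n, X ω n
  have hpt : ∀ ω n, pt ω ∈ Set.Icc (X ω n) (X ω n + ℓ / R ^ n) := fun ω n =>
    ⟨le_ciSup ⟨X ω 0 + ℓ / R ^ 0, by rintro _ ⟨m, rfl⟩; exact hle ω 0 m⟩ n,
      ciSup_le fun m => hle ω n m⟩
  have hXeq : ∀ ω ω' n, (∀ i < n, ω i = ω' i) → X ω n = X ω' n := by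
    intro ω ω' n
    induction n with
    | zero => intro _; rfl
    | succ k ih =>
      intro h
      rw [hXs, hXs, ih fun i hi => h i (by omega), h k (by omega)]
  have hdist : ∀ ω ω' n, (∀ i < n, ω i = ω' i) → ω n ≠ ω' n →
      ℓ / R ^ (n + 1) ≤ |pt ω - pt ω'| := by
    intro ω ω' n h hne
    have h1 := hsep n _ (hG ω n) _ _ hne
    have h2 := hpt ω (n + 1)
    have h3 := hpt ω' (n + 1)
    rw [hXs] at h2 h3
    rw [← hXeq ω ω' n h] at h3
    obtain ⟨h2a, h2b⟩ := h2
    obtain ⟨h3a, h3b⟩ := h3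
    rcases le_abs.1 h1 with h | h
    · exact le_abs.2 (Or.inl (by linarith))
    · exact le_abs.2 (Or.inr (by linarith))
  have hfirst : ∀ ω ω' : ℕ → Fin M, ω ≠ ω' → ∃ n, (∀ i < n, ω i = ω' i) ∧ ω n ≠ ω' n := by
    intro ω ω' h
    classical
    have hex : ∃ n, ω n ≠ ω' n := Function.ne_iff.1 h
    exact ⟨Nat.find hex, fun i hi => not_not.1 (Nat.find_min hex hi), Nat.find_spec hex⟩
  have hinj : Function.Injective pt := by
    intro ω ω' h
    by_contra hne
    obtain ⟨n, h1, h2⟩ := hfirst ω ω' hne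
    have := hdist ω ω' n h1 h2
    rw [h, sub_self, abs_zero] at this
    have : 0 < ℓ / R ^ (n + 1) := by positivity
    linarith
  have : Nonempty (ℕ → Fin M) := ⟨fun _ => ⟨0, by omega⟩⟩
  let F : ℝ → ℝ := fun y => Real.ofDigits (Function.invFun pt y)
  have hF : ∀ ω, F (pt ω) = Real.ofDigits ω := fun ω => by
    simp only [F, Function.leftInverse_invFun hinj ω]
  have hM' : (1 : ℝ) < M := by exact_mod_cast hM
  have hlR : 0 < Real.log R := Real.log_pos hR
  have hθpos : 0 < Real.log M / Real.log R := div_pos (Real.log_pos hM') hlR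
  set θ : ℝ := Real.log M / Real.log R with hθ
  have hRθ : R ^ θ = M := by
    rw [Real.rpow_def_of_pos hR0, hθ, mul_div_cancel₀ _ hlR.ne', Real.exp_log (by linarith)]
  let C : ℝ := M * (ℓ ^ θ)⁻¹
  have hCpos : 0 ≤ C := by positivity
  have hhol : HolderOnWith C.toNNReal θ.toNNReal F (Set.range pt) := by
    rintro _ ⟨ω, rfl⟩ _ ⟨ω', rfl⟩
    by_cases hne : ω = ω'
    · simp [hne]
    obtain ⟨n, h1, h2⟩ := hfirst ω ω' hne
    rw [hF, hF, edist_dist, edist_dist, Real.coe_toNNReal _ hθpos.le,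
      ENNReal.ofReal_rpow_of_nonneg dist_nonneg hθpos.le]
    change _ ≤ ENNReal.ofReal C * _
    rw [← ENNReal.ofReal_mul hCpos]
    apply ENNReal.ofReal_le_ofReal
    rw [Real.dist_eq, Real.dist_eq]
    refine (Real.abs_ofDigits_sub_ofDigits_le h1).trans ?_
    have h3 := Real.rpow_le_rpow (by positivity) (hdist ω ω' n h1 h2) hθpos.le
    rw [Real.div_rpow hℓ.le (by positivity), ← Real.rpow_natCast, ← Real.rpow_mul hR0.le, mul_comm _ θ,
      Real.rpow_mul hR0.le, hRθ, Real.rpow_natCast] at h3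
    refine le_trans ?_ (mul_le_mul_of_nonneg_left h3 hCpos)
    have hl : 0 < ℓ ^ θ := by positivity
    apply le_of_eq
    simp only [C]
    field_simp
    rw [pow_succ]
  have himg : Set.Icc (0 : ℝ) 1 ⊆ F '' Set.range pt := by
    intro y hy
    obtain ⟨ω, -, hω⟩ := Real.ofDigits_SurjOn hM hy
    exact ⟨pt ω, ⟨ω, rfl⟩, by rw [hF, hω]⟩
  have hIcc : dimH (Set.Icc (0 : ℝ) 1) = 1 := by
    rw [Real.dimH_of_nonempty_interior (by simp)]
    simp
  have h1 := hhol.dimH_image_le (Real.toNNReal_pos.2 hθpos)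
  have h2 := hIcc ▸ dimH_mono himg
  have h3 := h2.trans h1
  rw [ENNReal.le_div_iff_mul_le (by left; simpa using hθpos) (by left; exact ENNReal.coe_ne_top), one_mul] at h3
  refine h3.trans (dimH_mono ?_)
  rintro _ ⟨ω, rfl⟩ n
  exact ⟨X ω n, hG ω n, hpt ω n⟩

/-- A weighted avoidance principle: the sets `Z j` (obstacles) become relevant at level `a j` and
have to be avoided by level `a j + d j`.  If at each level the obstacles becoming relevant have small
total weight, then the set of points avoiding all the obstacles has almost full dimension. -/
theorem le_dimH_avoiding {J : Type*} {ρ : ℕ} (hρ : 1 ≤ ρ) {s₀ ℓ : ℝ} (hℓ : 0 < ℓ)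
    (Z : J → Set ℝ) (a d : J → ℕ) (hd : ∀ j, 1 ≤ d j)
    (hdiam : ∀ j, ∀ x ∈ Z j, ∀ y ∈ Z j, |x - y| < ℓ / (8 * ρ : ℝ) ^ (a j + d j))
    (hnew : ∀ n x, s₀ ≤ x → x + ℓ / (8 * ρ : ℝ) ^ n ≤ s₀ + ℓ →
      (∀ j, a j + d j ≤ n → ¬ (Z j ∩ Set.Icc x (x + ℓ / (8 * ρ : ℝ) ^ n)).Nonempty) →
      ∑' j, Set.indicator {j | a j = n ∧ (Z j ∩ Set.Icc x (x + ℓ / (8 * ρ : ℝ) ^ n)).Nonempty}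
        (fun j => ((ρ : ENNReal)⁻¹) ^ d j) j ≤ 1 / 4) :
    ENNReal.ofReal (Real.log (2 * ρ) / Real.log (8 * ρ)) ≤
      dimH {y : ℝ | y ∈ Set.Icc s₀ (s₀ + ℓ) ∧ ∀ j, y ∉ Z j} := by
  set R : ℝ := 8 * ρ with hRdef
  have hρ' : (1 : ℝ) ≤ ρ := by exact_mod_cast hρ
  have hR : 1 < R := by rw [hRdef]; linarith
  have hR0 : 0 < R := by linarith
  have hρ0 : (ρ : ENNReal) ≠ 0 := by simp; omega
  have hρt : (ρ : ENNReal) ≠ ⊤ := by simp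
  have hinv : (ρ : ENNReal) * (ρ : ENNReal)⁻¹ = 1 := ENNReal.mul_inv_cancel hρ0 hρt
  have hρ1 : (1 : ENNReal) ≤ ρ := by exact_mod_cast hρ
  let hit : ℕ → ℝ → J → Prop := fun n x j => (Z j ∩ Set.Icc x (x + ℓ / R ^ n)).Nonempty
  let wt : ℕ → J → ENNReal := fun n j => (ρ : ENNReal) ^ n * ((ρ : ENNReal)⁻¹) ^ (a j + d j)
  let Φ : ℕ → ℝ → ENNReal := fun n x => ∑' j, Set.indicator {j | a j ≤ n ∧ hit n x j} (wt n) j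
  have hwt1 : ∀ n j, a j + d j ≤ n → 1 ≤ wt n j := by
    intro n j h
    simp only [wt]
    obtain ⟨k, rfl⟩ := Nat.exists_eq_add_of_le h
    rw [pow_add, mul_assoc, mul_comm, mul_assoc, ← mul_pow, mul_comm _ (ρ : ENNReal), hinv, one_pow,
      mul_one]
    exact one_le_pow₀ hρ1
  have hwtle : ∀ j m (P : J → Prop), P j → a j + d j ≤ m →
      1 ≤ ∑' j, Set.indicator {j | P j} (wt m) j := by
    intro j m P hP h
    refine le_trans ?_ (ENNReal.le_tsum j)
    rw [Set.indicator_of_mem (by exact hP)]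
    exact hwt1 m j h
  let G : ℕ → ℝ → Prop := fun n x => s₀ ≤ x ∧ x + ℓ / R ^ n ≤ s₀ + ℓ ∧ Φ n x ≤ 1 / 2
  have hhalf : ¬ (1 : ENNReal) ≤ 1 / 2 := by
    rw [not_le]; simp
  have hquarter : ¬ (1 : ENNReal) ≤ 1 / 4 := by
    rw [not_le]; simp
  have hmiss : ∀ n x j, G n x → a j + d j ≤ n → ¬ hit n x j := fun n x j hG h hh =>
    hhalf ((hwtle j n (fun j => a j ≤ n ∧ hit n x j) ⟨by omega, hh⟩ h).trans hG.2.2)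
  have h0 : G 0 s₀ := by
    refine ⟨le_rfl, by simp, ?_⟩
    have h := hnew 0 s₀ le_rfl (by simp) (fun j hj => by have := hd j; omega)
    refine le_trans (le_trans (le_of_eq ?_) h) (by gcongr; norm_num)
    refine tsum_congr fun j => ?_
    by_cases hj : a j = 0 ∧ hit 0 s₀ j
    · rw [Set.indicator_of_mem (by exact ⟨hj.1.le, hj.2⟩), Set.indicator_of_mem (by exact hj)]
      simp [wt, hj.1]
    · rw [Set.indicator_of_notMem, Set.indicator_of_notMem]
      · exact hj
      · exact fun h' => hj ⟨Nat.le_zero.1 h'.1, h'.2⟩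
  have step : ∀ n x, G n x → ∃ c : Fin (2 * ρ) → ℝ,
      (∀ i, G (n + 1) (c i) ∧ x ≤ c i ∧ c i + ℓ / R ^ (n + 1) ≤ x + ℓ / R ^ n) ∧
      ∀ i i', i ≠ i' → 2 * (ℓ / R ^ (n + 1)) ≤ |c i - c i'| := by
    intro n x hG
    set r := ℓ / R ^ (n + 1) with hr
    have hr0 : 0 < r := by positivity
    have hrR : ℓ / R ^ n = 8 * ρ * r := by
      rw [hr, pow_succ, ← hRdef]; field_simp
    let ch : Fin (4 * ρ) → ℝ := fun k => x + 2 * (k : ℕ) * r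
    have hkb : ∀ k : Fin (4 * ρ), ((k : ℕ) : ℝ) + 1 ≤ 4 * ρ := fun k => by
      exact_mod_cast k.2
    have hchl : ∀ k, x ≤ ch k := fun k => by simp only [ch]; have := hkb k; nlinarith [(k : ℕ).cast_nonneg (α := ℝ)]
    have hchr : ∀ k, ch k + r ≤ x + ℓ / R ^ n := fun k => by
      rw [hrR]; simp only [ch]; nlinarith [hkb k]
    have hsep : ∀ k k', k ≠ k' → 2 * r ≤ |ch k - ch k'| := by
      intro k k' hne
      have h1 : (1 : ℝ) ≤ |((k : ℕ) : ℝ) - ((k' : ℕ) : ℝ)| := by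
        have : ((k : ℕ) : ℤ) - ((k' : ℕ) : ℤ) ≠ 0 := by
          intro h; apply hne; ext; omega
        exact_mod_cast Int.one_le_abs this
      have h2 : ch k - ch k' = (2 * r) * (((k : ℕ) : ℝ) - ((k' : ℕ) : ℝ)) := by simp only [ch]; ring
      rw [h2, abs_mul, abs_of_pos (by linarith : 0 < 2 * r)]
      nlinarith
    let old : Fin (4 * ρ) → ENNReal := fun k =>
      ∑' j, Set.indicator {j | a j ≤ n ∧ hit (n + 1) (ch k) j} (wt (n + 1)) j
    have hhit : ∀ k j, hit (n + 1) (ch k) j → hit n x j := by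
      rintro k j ⟨z, hz, hz1, hz2⟩
      exact ⟨z, hz, (hchl k).trans hz1, hz2.trans (hchr k)⟩
    have huniq : ∀ k k' j, a j ≤ n → hit (n + 1) (ch k) j → hit (n + 1) (ch k') j → k = k' := by
      intro k k' j haj hk hk'
      by_contra hne
      have hlate : n + 1 ≤ a j + d j := by
        by_contra hlt
        exact hmiss n x j hG (by omega) (hhit k j hk)
      obtain ⟨z, hz, hz1, hz2⟩ := hk
      obtain ⟨z', hz', hz1', hz2'⟩ := hk'
      have h1 := hdiam j z hz z' hz'
      have h2 : ℓ / R ^ (a j + d j) ≤ r := by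
        apply div_le_div_of_nonneg_left hℓ.le (by positivity)
        exact pow_le_pow_right₀ hR.le hlate
      have h3 := hsep k k' hne
      rw [abs_lt] at h1
      rcases le_abs.1 h3 with h | h <;> linarith [h1.1, h1.2]
    have hold : ∑ k, old k ≤ ρ * (1 / 2) := by
      calc ∑ k, old k = ∑' j, ∑ k, Set.indicator {j | a j ≤ n ∧ hit (n + 1) (ch k) j} (wt (n + 1)) j :=
            (Summable.tsum_finsetSum fun _ _ => ENNReal.summable).symm
        _ ≤ ∑' j, ρ * Set.indicator {j | a j ≤ n ∧ hit n x j} (wt n) j := by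
            refine ENNReal.tsum_le_tsum fun j => ?_
            by_cases hex : ∃ k, a j ≤ n ∧ hit (n + 1) (ch k) j
            · obtain ⟨k, hk1, hk2⟩ := hex
              rw [Finset.sum_eq_single k, Set.indicator_of_mem (by exact ⟨hk1, hk2⟩),
                Set.indicator_of_mem (by exact ⟨hk1, hhit k j hk2⟩)]
              · simp only [wt, pow_succ]
                apply le_of_eq; ring
              · intro k' _ hne
                rw [Set.indicator_of_notMem]
                exact fun h => hne (huniq k' k j hk1 h.2 hk2)
              · simp
            · push Not at hex
              rw [Finset.sum_eq_zero]
              · simp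
              · intro k _
                rw [Set.indicator_of_notMem]
                exact fun h => hex k h.1 h.2
        _ = ρ * Φ n x := ENNReal.tsum_mul_left
        _ ≤ _ := by gcongr; exact hG.2.2
    classical
    let good : Finset (Fin (4 * ρ)) := Finset.univ.filter fun k => old k ≤ 1 / 4
    have hcard : 2 * ρ ≤ good.card := by
      let bad : Finset (Fin (4 * ρ)) := Finset.univ.filter fun k => ¬ old k ≤ 1 / 4
      have hb : bad.card ≤ 2 * ρ := by
        have h1 : (bad.card : ENNReal) * (1 / 4) ≤ ρ * (1 / 2) := by
          rw [← nsmul_eq_mul]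
          refine (Finset.card_nsmul_le_sum bad old (1 / 4) fun k hk => ?_).trans
            ((Finset.sum_le_sum_of_subset (Finset.subset_univ _)).trans hold)
          exact (not_le.1 (Finset.mem_filter.1 hk).2).le
        have h2 := ENNReal.toReal_mono (by finiteness) h1
        simp only [ENNReal.toReal_mul, ENNReal.toReal_natCast, ENNReal.toReal_div, ENNReal.toReal_one,
          ENNReal.toReal_ofNat] at h2
        have h3 : (bad.card : ℝ) ≤ 2 * ρ := by linarith
        exact_mod_cast h3
      have h4 : good.card + bad.card = 4 * ρ := by
        have := Finset.card_filter_add_card_filter_not (s := (Finset.univ : Finset (Fin (4 * ρ))))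
          (fun k => old k ≤ 1 / 4)
        rwa [Finset.card_univ, Fintype.card_fin] at this
      omega
    have hgoodG : ∀ k ∈ good, G (n + 1) (ch k) := by
      intro k hk
      have hk' : old k ≤ 1 / 4 := (Finset.mem_filter.1 hk).2
      refine ⟨hG.1.trans (hchl k), (hchr k).trans hG.2.1, ?_⟩
      have hn := hnew (n + 1) (ch k) (hG.1.trans (hchl k)) ((hchr k).trans hG.2.1) (by
        intro j hj hh
        have hdj := hd j
        exact hquarter ((hwtle j (n + 1) (fun j => a j ≤ n ∧ hit (n + 1) (ch k) j)
          ⟨by omega, hh⟩ hj).trans hk'))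
      calc Φ (n + 1) (ch k) ≤ ∑' j, (Set.indicator {j | a j ≤ n ∧ hit (n + 1) (ch k) j} (wt (n + 1)) j +
            Set.indicator {j | a j = n + 1 ∧ hit (n + 1) (ch k) j} (fun j => ((ρ : ENNReal)⁻¹) ^ d j) j) := by
            refine ENNReal.tsum_le_tsum fun j => ?_
            by_cases hh : a j ≤ n + 1 ∧ hit (n + 1) (ch k) j
            · rw [Set.indicator_of_mem (by exact hh)]
              rcases Nat.lt_or_ge n (a j) with h | h
              · have h' : a j = n + 1 := by omega
                rw [Set.indicator_of_mem (s := {j | a j = n + 1 ∧ hit (n + 1) (ch k) j}) (by exact ⟨h', hh.2⟩)]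
                refine le_trans (le_of_eq ?_) le_add_self
                simp only [wt]
                rw [h', pow_add _ (n + 1), ← mul_assoc, ← mul_pow, hinv, one_pow, one_mul]
              · rw [Set.indicator_of_mem (s := {j | a j ≤ n ∧ hit (n + 1) (ch k) j}) (by exact ⟨h, hh.2⟩)]
                exact le_self_add
            · rw [Set.indicator_of_notMem (by exact hh)]
              exact zero_le
        _ = old k + _ := ENNReal.tsum_add
        _ ≤ 1 / 4 + 1 / 4 := add_le_add hk' hn
        _ = 1 / 2 := by
          rw [ENNReal.div_add_div_same, ENNReal.div_eq_div_iff] <;> norm_num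
    let e := good.orderEmbOfCardLe hcard
    refine ⟨fun i => ch (e i), fun i => ⟨hgoodG _ (good.orderEmbOfCardLe_mem hcard i), hchl _, hchr _⟩,
      fun i i' hne => hsep _ _ fun h => hne (e.injective h)⟩
  have key := le_dimH_of_nested_intervals hR hℓ (M := 2 * ρ) (by omega) G h0 step
  push_cast at key
  refine key.trans (dimH_mono ?_)
  intro y hy
  refine ⟨?_, fun j hj => ?_⟩
  · obtain ⟨x, hx, hx1, hx2⟩ := hy 0
    exact ⟨hx.1.trans hx1, hx2.trans hx.2.1⟩
  · obtain ⟨x, hx, hxy⟩ := hy (a j + d j)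
    exact hmiss _ x j hx le_rfl ⟨y, hj, hxy⟩

/-- The form `XY`, written in the coordinates `X = (P√σ + M/√σ)/2`, `Y = (P√σ - M/√σ)/2`. -/
noncomputable def hypForm (P M σ : ℝ) : ℝ := (P ^ 2 * σ - M ^ 2 / σ) / 4

theorem hypForm_sub {P M σ σ' : ℝ} (h : 0 < σ) (h' : 0 < σ') :
    hypForm P M σ - hypForm P M σ' = (σ - σ') * (P ^ 2 + M ^ 2 / (σ * σ')) / 4 := by
  unfold hypForm
  field_simp
  ring

theorem abs_hypForm_le {P M σ D : ℝ} (hD : 1 ≤ D) (h : D⁻¹ ≤ σ) (h' : σ ≤ D) :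
    |hypForm P M σ| ≤ D * (P ^ 2 + M ^ 2) / 4 := by
  have hD0 : 0 < D := by linarith
  have hσ : 0 < σ := lt_of_lt_of_le (by positivity) h
  have h1 : M ^ 2 / σ ≤ D * M ^ 2 := by
    rw [div_le_iff₀ hσ]
    have : 1 ≤ D * σ := by rwa [inv_le_iff_one_le_mul₀' hD0] at h
    nlinarith [sq_nonneg M]
  have h2 : P ^ 2 * σ ≤ P ^ 2 * D := mul_le_mul_of_nonneg_left h' (sq_nonneg P)
  have h3 : 0 ≤ M ^ 2 / σ := by positivity
  have h4 : 0 ≤ P ^ 2 * σ := by positivity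
  unfold hypForm
  rw [abs_le]
  constructor <;> nlinarith [mul_nonneg hD0.le (sq_nonneg P), mul_nonneg hD0.le (sq_nonneg M)]

theorem abs_hypForm_sub_le {P M σ σ' D : ℝ} (hD : 1 ≤ D) (h : D⁻¹ ≤ σ) (h' : D⁻¹ ≤ σ') :
    |hypForm P M σ - hypForm P M σ'| ≤ |σ - σ'| * (D ^ 2 * (P ^ 2 + M ^ 2)) / 4 := by
  have hD0 : 0 < D := by linarith
  have hσ : 0 < σ := lt_of_lt_of_le (by positivity) h
  have hσ' : 0 < σ' := lt_of_lt_of_le (by positivity) h'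
  have h1 : 1 ≤ D * σ := by rwa [inv_le_iff_one_le_mul₀' hD0] at h
  have h2 : 1 ≤ D * σ' := by rwa [inv_le_iff_one_le_mul₀' hD0] at h'
  have h3 : M ^ 2 / (σ * σ') ≤ D ^ 2 * M ^ 2 := by
    rw [div_le_iff₀ (by positivity)]
    have : 1 ≤ (D * σ) * (D * σ') := by nlinarith
    nlinarith [sq_nonneg M]
  rw [hypForm_sub hσ hσ', abs_div, abs_mul, abs_of_nonneg (by positivity : 0 ≤ P ^ 2 + M ^ 2 / (σ * σ')),
    abs_of_pos (by norm_num : (0 : ℝ) < 4)]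
  gcongr
  nlinarith [mul_le_mul_of_nonneg_right (one_le_pow₀ hD : 1 ≤ D ^ 2) (sq_nonneg P)]

theorem le_abs_hypForm_sub {P M σ σ' D : ℝ} (hD : 1 ≤ D) (h : 0 < σ) (h' : 0 < σ')
    (hσD : σ ≤ D) (hσD' : σ' ≤ D) :
    |σ - σ'| * (P ^ 2 + M ^ 2) ≤ 4 * D ^ 2 * |hypForm P M σ - hypForm P M σ'| := by
  have hD0 : 0 < D := by linarith
  have h3 : M ^ 2 ≤ D ^ 2 * (M ^ 2 / (σ * σ')) := by
    rw [← mul_div_assoc, le_div_iff₀ (by positivity)]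
    have : σ * σ' ≤ D ^ 2 := by nlinarith
    nlinarith [sq_nonneg M]
  rw [hypForm_sub h h', abs_div, abs_mul, abs_of_nonneg (by positivity : 0 ≤ P ^ 2 + M ^ 2 / (σ * σ')),
    abs_of_pos (by norm_num : (0 : ℝ) < 4)]
  have h4 : P ^ 2 + M ^ 2 ≤ D ^ 2 * (P ^ 2 + M ^ 2 / (σ * σ')) := by
    nlinarith [mul_le_mul_of_nonneg_right (one_le_pow₀ hD : 1 ≤ D ^ 2) (sq_nonneg P)]
  calc |σ - σ'| * (P ^ 2 + M ^ 2) ≤ |σ - σ'| * (D ^ 2 * (P ^ 2 + M ^ 2 / (σ * σ'))) := by gcongr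
    _ = _ := by ring

noncomputable def hypX (P M σ : ℝ) : ℝ := (P * √σ + M / √σ) / 2

noncomputable def hypY (P M σ : ℝ) : ℝ := (P * √σ - M / √σ) / 2

theorem hypX_mul_hypY {P M σ : ℝ} (h : 0 < σ) : hypX P M σ * hypY P M σ = hypForm P M σ := by
  have h1 := Real.sq_sqrt h.le
  have h2 : 0 < √σ := Real.sqrt_pos.2 h
  calc hypX P M σ * hypY P M σ = (P ^ 2 * √σ ^ 2 - M ^ 2 / √σ ^ 2) / 4 := by
        unfold hypX hypY; field_simp; ring
    _ = _ := by rw [h1, hypForm]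

theorem hypX_sq_add_hypY_sq {P M σ : ℝ} (h : 0 < σ) :
    hypX P M σ ^ 2 + hypY P M σ ^ 2 = (P ^ 2 * σ + M ^ 2 / σ) / 2 := by
  have h1 := Real.sq_sqrt h.le
  have h2 : 0 < √σ := Real.sqrt_pos.2 h
  calc hypX P M σ ^ 2 + hypY P M σ ^ 2 = (P ^ 2 * √σ ^ 2 + M ^ 2 / √σ ^ 2) / 2 := by
        unfold hypX hypY; field_simp; ring
    _ = _ := by rw [h1]

theorem hypX_sq_add_hypY_sq_le {P M σ D : ℝ} (hD : 1 ≤ D) (h : D⁻¹ ≤ σ) (h' : σ ≤ D) :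
    hypX P M σ ^ 2 + hypY P M σ ^ 2 ≤ D * (P ^ 2 + M ^ 2) / 2 := by
  have hD0 : 0 < D := by linarith
  have hσ : 0 < σ := lt_of_lt_of_le (by positivity) h
  rw [hypX_sq_add_hypY_sq hσ]
  have h1 : M ^ 2 / σ ≤ D * M ^ 2 := by
    rw [div_le_iff₀ hσ]
    have : 1 ≤ D * σ := by rwa [inv_le_iff_one_le_mul₀' hD0] at h
    nlinarith [sq_nonneg M]
  nlinarith [mul_le_mul_of_nonneg_left h' (sq_nonneg P)]

theorem le_hypX_sq_add_hypY_sq {P M σ D : ℝ} (hD : 1 ≤ D) (h : D⁻¹ ≤ σ) (h' : σ ≤ D) :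
    P ^ 2 + M ^ 2 ≤ 2 * D * (hypX P M σ ^ 2 + hypY P M σ ^ 2) := by
  have hD0 : 0 < D := by linarith
  have hσ : 0 < σ := lt_of_lt_of_le (by positivity) h
  rw [hypX_sq_add_hypY_sq hσ]
  have h1 : M ^ 2 ≤ D * (M ^ 2 / σ) := by
    rw [← mul_div_assoc, le_div_iff₀ hσ]
    nlinarith [sq_nonneg M]
  have : 1 ≤ D * σ := by rwa [inv_le_iff_one_le_mul₀' hD0] at h
  nlinarith [sq_nonneg P]

theorem hypX_sub (P M P' M' σ : ℝ) : hypX P M σ - hypX P' M' σ = hypX (P - P') (M - M') σ := by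
  unfold hypX; ring

theorem hypY_sub (P M P' M' σ : ℝ) : hypY P M σ - hypY P' M' σ = hypY (P - P') (M - M') σ := by
  unfold hypY; ring

theorem hypX_mul_hypY_sub {P M P' M' σ : ℝ} (h : 0 < σ) :
    hypX P M σ * hypY P' M' σ - hypX P' M' σ * hypY P M σ = (M * P' - P * M') / 2 := by
  have h2 : 0 < √σ := Real.sqrt_pos.2 h
  unfold hypX hypY
  field_simp
  ring

/-- Two vectors close to the same axis and of comparable lengths span a small area. -/
theorem abs_det_lt_one {X Y X' Y' μ lo hi κ : ℝ} (hlo : 0 < lo) (hκ : 0 < κ)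
    (h1 : |X * Y| ≤ μ) (h1' : |X' * Y'| ≤ μ) (hXY : |X| ≤ |Y|) (hXY' : |X'| ≤ |Y'|)
    (hl : lo ≤ X ^ 2 + Y ^ 2) (hl' : lo ≤ X' ^ 2 + Y' ^ 2)
    (hh : X ^ 2 + Y ^ 2 ≤ hi) (hh' : X' ^ 2 + Y' ^ 2 ≤ hi)
    (hκ' : 2 * hi ≤ κ ^ 2 * lo) (hμ : 2 * μ * κ < 1) : |X * Y' - X' * Y| < 1 := by
  have key : ∀ X Y X' Y' : ℝ, |X * Y| ≤ μ → |X| ≤ |Y| → lo ≤ X ^ 2 + Y ^ 2 → X' ^ 2 + Y' ^ 2 ≤ hi →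
      |X * Y'| ≤ μ * κ := by
    intro X Y X' Y' h1 hXY hl hh'
    have hY2 : lo ≤ 2 * Y ^ 2 := by have := sq_le_sq.2 hXY; linarith
    have hY0 : 0 < |Y| := by
      rw [abs_pos]; rintro rfl; linarith [hY2, (by norm_num : (2 : ℝ) * 0 ^ 2 = 0)]
    have h2 : |Y'| ≤ κ * |Y| := by
      refine abs_le_of_sq_le_sq ?_ (by positivity)
      rw [mul_pow, sq_abs]
      nlinarith [sq_nonneg X', mul_le_mul_of_nonneg_left hY2 (sq_nonneg κ)]
    rw [abs_mul] at h1 ⊢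
    nlinarith [abs_nonneg X, mul_le_mul_of_nonneg_left h2 (abs_nonneg X),
      mul_le_mul_of_nonneg_right h1 hκ.le]
  have ha := key X Y X' Y' h1 hXY hl hh'
  have hb := key X' Y' X Y h1' hXY' hl' hh
  have hc := abs_sub (X * Y') (X' * Y)
  linarith

theorem eq_or_eq_neg_of_det_eq_zero {q q' : ℤ × ℤ} (h : IsCoprime q.1 q.2) (h' : IsCoprime q'.1 q'.2)
    (hdet : q.1 * q'.2 = q.2 * q'.1) : q' = q ∨ q' = -q := by
  obtain ⟨x, y⟩ := q
  obtain ⟨x', y'⟩ := q'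
  simp only at *
  have h1 : x ∣ x' := h.dvd_of_dvd_mul_left ⟨y', by linarith⟩
  have h2 : x' ∣ x := h'.dvd_of_dvd_mul_right ⟨y, by linarith⟩
  have h3 : y ∣ y' := h.symm.dvd_of_dvd_mul_left ⟨x', by linarith⟩
  have h4 : y' ∣ y := h'.symm.dvd_of_dvd_mul_right ⟨x, by linarith⟩
  rcases Int.associated_iff.1 (associated_of_dvd_dvd h1 h2) with hx | hx <;>
  rcases Int.associated_iff.1 (associated_of_dvd_dvd h3 h4) with hy | hy
  · left; simp [hx, hy]
  · subst hx
    rw [hy] at hdet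
    have : x * y' = 0 := by nlinarith
    rcases mul_eq_zero.1 this with h0 | h0
    · right; simp [hy, h0]
    · left; simp [hy, h0]
  · subst hy
    rw [hx] at hdet
    have : x' * y = 0 := by nlinarith
    rcases mul_eq_zero.1 this with h0 | h0
    · left; simp [hx, h0]
    · right; simp [hx, h0]
  · right; simp [hx, hy]

theorem encard_le_two_of_forall_eq_or_neg {T : Set (ℤ × ℤ)}
    (h : ∀ q ∈ T, ∀ q' ∈ T, q' = q ∨ q' = -q) : T.encard ≤ 2 := by
  rcases T.eq_empty_or_nonempty with rfl | ⟨q, hq⟩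
  · simp
  · refine (Set.encard_le_encard (t := {q, -q}) fun q' hq' => h q hq q' hq').trans ?_
    refine (Set.encard_insert_le _ _).trans ?_
    rw [Set.encard_singleton]; norm_num

/-- A separated subset of a box is finite, with a bound depending only on the separation. -/
theorem exists_encard_le_of_separated {C η : ℝ} (hη : 0 < η) : ∃ K : ℕ,
    ∀ {ι : Type} (T : Set ι) (u v : ι → ℝ), (∀ m ∈ T, |u m| ≤ C ∧ |v m| ≤ C) →
      (∀ m ∈ T, ∀ m' ∈ T, |u m - u m'| < η → |v m - v m'| < η → m = m') → T.encard ≤ K := by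
  let k : ℤ := ⌈C / η⌉ + 1
  let S : Finset (ℤ × ℤ) := Finset.Icc (-k) k ×ˢ Finset.Icc (-k) k
  refine ⟨S.card, fun T u v hC hsep => ?_⟩
  have hk : ∀ x : ℝ, |x| ≤ C → ⌊x / η⌋ ∈ Finset.Icc (-k) k := by
    intro x hx
    rw [abs_le] at hx
    have h0 : C / η ≤ ⌈C / η⌉ := Int.le_ceil _
    have h1 : x / η ≤ C / η := by gcongr; exact hx.2
    have h2 : -(C / η) ≤ x / η := by rw [← neg_div]; gcongr; exact hx.1
    rw [Finset.mem_Icc]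
    constructor
    · rw [Int.le_floor]; simp only [k]; push_cast; linarith
    · have : (⌊x / η⌋ : ℝ) ≤ k := by
        have := Int.floor_le (x / η)
        simp only [k]; push_cast; linarith
      exact_mod_cast this
  have hfl : ∀ x y : ℝ, ⌊x / η⌋ = ⌊y / η⌋ → |x - y| < η := by
    intro x y h
    have := Int.abs_sub_lt_one_of_floor_eq_floor h
    rwa [← sub_div, abs_div, abs_of_pos hη, div_lt_one hη] at this
  rw [← Set.encard_coe_eq_coe_finsetCard]
  refine Set.encard_le_encard_of_injOn (f := fun m => (⌊u m / η⌋, ⌊v m / η⌋)) ?_ ?_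
  · intro m hm
    exact Finset.mem_coe.2 (Finset.mk_mem_product (hk _ (hC m hm).1) (hk _ (hC m hm).2))
  · intro m hm m' hm' h
    simp only [Prod.mk.injEq] at h
    exact hsep m hm m' hm' (hfl _ _ h.1) (hfl _ _ h.2)

theorem hypForm_mul (k P M σ : ℝ) : hypForm (k * P) (k * M) σ = k ^ 2 * hypForm P M σ := by
  unfold hypForm; ring

/-- Two points of `[D⁻¹, D]` at which `hypForm P M` is close to the same value are close. -/
theorem abs_sub_lt_of_abs_hypForm_le {P M b D ε L x y : ℝ} (hD : 1 ≤ D)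
    (hx : D⁻¹ ≤ x) (hxD : x ≤ D) (hy : D⁻¹ ≤ y) (hyD : y ≤ D)
    (hfx : |hypForm P M x - b| ≤ ε) (hfy : |hypForm P M y - b| ≤ ε)
    (hN : 0 < P ^ 2 + M ^ 2) (hL : 8 * D ^ 2 * ε < L * (P ^ 2 + M ^ 2)) : |x - y| < L := by
  have hD0 : 0 < D⁻¹ := inv_pos.2 (by linarith)
  have h1 := le_abs_hypForm_sub (P := P) (M := M) hD (hD0.trans_le hx) (hD0.trans_le hy) hxD hyD
  have h2 : |hypForm P M x - hypForm P M y| ≤ 2 * ε := by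
    have := abs_sub_le (hypForm P M x) b (hypForm P M y)
    rw [abs_sub_comm b] at this
    linarith
  have h3 : |x - y| * (P ^ 2 + M ^ 2) < L * (P ^ 2 + M ^ 2) := by nlinarith [sq_nonneg D]
  exact lt_of_mul_lt_mul_right h3 hN.le

theorem one_le_mul_sq_add_sq {α β : ℝ} {q : ℤ × ℤ} (hq : q ≠ 0) :
    1 ≤ (1 + β ^ 2) * ((q.1 + α * q.2) ^ 2 + (β * q.1 + (β * α - 2) * q.2) ^ 2) := by
  have key : 4 * (q.2 : ℝ) ^ 2 ≤
      (1 + β ^ 2) * ((q.1 + α * q.2) ^ 2 + (β * q.1 + (β * α - 2) * q.2) ^ 2) := by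
    nlinarith [sq_nonneg ((q.1 + α * q.2) + β * (β * q.1 + (β * α - 2) * q.2))]
  have hsq_int : ∀ z : ℤ, z ≠ 0 → (1 : ℝ) ≤ (z : ℝ) ^ 2 := fun z hz => by
    have : 1 ≤ z ^ 2 := by have := sq_pos_of_ne_zero hz; omega
    exact_mod_cast this
  by_cases h2 : q.2 = 0
  · have h1 : q.1 ≠ 0 := fun h1 => hq (Prod.ext h1 h2)
    have := hsq_int _ h1
    simp only [h2, Int.cast_zero, mul_zero, add_zero]
    nlinarith [sq_nonneg (β * q.1), sq_nonneg β, mul_nonneg (sq_nonneg β) (sq_nonneg (β * q.1))]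
  · linarith [hsq_int _ h2]

/-- At a given scale there are at most four primitive vectors at which the form is small. -/
theorem encard_le_four_of_abs_hypForm_le {α β D R L μ x : ℝ} (hD : 1 ≤ D) (hR : 1 ≤ R) (hL : 0 < L)
    (hμ : 4 * μ * D * R < 1) (hx : D⁻¹ ≤ x) (hxD : x ≤ D) {T : Set (ℤ × ℤ)}
    (hT : ∀ q ∈ T, IsCoprime q.1 q.2)
    (hl : ∀ q ∈ T, L ≤ (q.1 + α * q.2) ^ 2 + (β * q.1 + (β * α - 2) * q.2) ^ 2)
    (hh : ∀ q ∈ T, (q.1 + α * q.2) ^ 2 + (β * q.1 + (β * α - 2) * q.2) ^ 2 ≤ R * L)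
    (hf : ∀ q ∈ T, |hypForm (q.1 + α * q.2) (β * q.1 + (β * α - 2) * q.2) x| ≤ μ) :
    T.encard ≤ 4 := by
  have hx0 : 0 < x := (inv_pos.2 (by linarith)).trans_le hx
  have hD0 : 0 < D := by linarith
  have hR0 : 0 < R := by linarith
  let X : ℤ × ℤ → ℝ := fun q => hypX (q.1 + α * q.2) (β * q.1 + (β * α - 2) * q.2) x
  let Y : ℤ × ℤ → ℝ := fun q => hypY (q.1 + α * q.2) (β * q.1 + (β * α - 2) * q.2) x
  have hprod : ∀ q ∈ T, |X q * Y q| ≤ μ := fun q hq => by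
    simp only [X, Y]; rw [hypX_mul_hypY hx0]; exact hf q hq
  have hlo : ∀ q ∈ T, L / (2 * D) ≤ X q ^ 2 + Y q ^ 2 := fun q hq => by
    rw [div_le_iff₀ (by positivity)]
    have := le_hypX_sq_add_hypY_sq (P := q.1 + α * q.2) (M := β * q.1 + (β * α - 2) * q.2) hD hx hxD
    have := hl q hq
    simp only [X, Y]; linarith
  have hhi : ∀ q ∈ T, X q ^ 2 + Y q ^ 2 ≤ D * (R * L) / 2 := fun q hq => by
    have := hypX_sq_add_hypY_sq_le (P := q.1 + α * q.2) (M := β * q.1 + (β * α - 2) * q.2) hD hx hxD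
    have := mul_le_mul_of_nonneg_left (hh q hq) hD0.le
    simp only [X, Y]; linarith
  have hκ : 2 * (D * (R * L) / 2) ≤ (2 * D * R) ^ 2 * (L / (2 * D)) := by
    have : (2 * D * R) ^ 2 * (L / (2 * D)) = 2 * D * R ^ 2 * L := by field_simp
    rw [this]
    nlinarith [mul_pos (mul_pos hD0 hR0) hL]
  have hdet : ∀ q q' : ℤ × ℤ, |X q * Y q' - X q' * Y q| < 1 → q.1 * q'.2 = q.2 * q'.1 := by
    intro q q' h
    simp only [X, Y] at h
    rw [hypX_mul_hypY_sub hx0] at h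
    have h' : |((q.1 * q'.2 - q.2 * q'.1 : ℤ) : ℝ)| < 1 := by
      convert h using 2; push_cast; ring
    have : q.1 * q'.2 - q.2 * q'.1 = 0 := Int.abs_lt_one_iff.1 (by exact_mod_cast h')
    linarith
  have hμ' : 2 * μ * (2 * D * R) < 1 := by linarith
  have hsplit : T ⊆ {q ∈ T | |X q| ≤ |Y q|} ∪ {q ∈ T | |Y q| ≤ |X q|} := fun q hq =>
    (le_total |X q| |Y q|).imp (fun h => ⟨hq, h⟩) (fun h => ⟨hq, h⟩)
  refine (Set.encard_le_encard hsplit).trans ((Set.encard_union_le _ _).trans ?_)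
  rw [show (4 : ℕ∞) = 2 + 2 by norm_num]
  refine add_le_add (encard_le_two_of_forall_eq_or_neg fun q hq q' hq' => ?_)
    (encard_le_two_of_forall_eq_or_neg fun q hq q' hq' => ?_)
  · exact eq_or_eq_neg_of_det_eq_zero (hT q hq.1) (hT q' hq'.1) <| hdet q q' <|
      abs_det_lt_one (by positivity) (by positivity) (hprod q hq.1) (hprod q' hq'.1) hq.2 hq'.2
        (hlo q hq.1) (hlo q' hq'.1) (hhi q hq.1) (hhi q' hq'.1) hκ hμ'
  · refine eq_or_eq_neg_of_det_eq_zero (hT q hq.1) (hT q' hq'.1) (hdet q q' ?_)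
    have := abs_det_lt_one (X := Y q) (Y := X q) (X' := Y q') (Y' := X q') (μ := μ)
      (lo := L / (2 * D)) (hi := D * (R * L) / 2) (κ := 2 * D * R) (by positivity) (by positivity)
      (by rw [mul_comm]; exact hprod q hq.1) (by rw [mul_comm]; exact hprod q' hq'.1) hq.2 hq'.2
      (by rw [add_comm]; exact hlo q hq.1) (by rw [add_comm]; exact hlo q' hq'.1)
      (by rw [add_comm]; exact hhi q hq.1) (by rw [add_comm]; exact hhi q' hq'.1) hκ hμ'
    rw [abs_sub_comm]
    convert this using 2
    ring

/-- At a given scale, boundedly many vectors whose differences stay away from the axes can have a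
bounded value of the form. -/
theorem exists_encard_le_of_abs_hypForm_le {C η D R : ℝ} (hη : 0 < η) (hC : 0 ≤ C) (hD : 1 ≤ D)
    (hR : 1 ≤ R) : ∃ K : ℕ, ∀ {ι : Type} (T : Set ι) (P M : ι → ℝ) (L x : ℝ), 1 ≤ L →
      D⁻¹ ≤ x → x ≤ D → (∀ m ∈ T, |hypForm (P m) (M m) x| ≤ C) →
      (∀ m ∈ T, P m ^ 2 + M m ^ 2 ≤ R * L) → (∀ m ∈ T, L = 1 ∨ L ≤ P m ^ 2 + M m ^ 2) →
      (∀ m ∈ T, ∀ m' ∈ T, |hypForm (P m - P m') (M m - M m') x| < η ^ 2 →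
        (P m - P m') ^ 2 + (M m - M m') ^ 2 < 4 * D * η ^ 2 * L → m = m') → T.encard ≤ K := by
  obtain ⟨K, hK⟩ := exists_encard_le_of_separated (C := 2 * D * C + D * R) hη
  refine ⟨K + K, fun {ι} T P M L x hL hx hxD hf hN hN' hsep => ?_⟩
  have hx0 : 0 < x := (inv_pos.2 (by linarith)).trans_le hx
  have hD0 : 0 < D := by linarith
  have hR0 : 0 < R := by linarith
  let X : ι → ℝ := fun m => hypX (P m) (M m) x
  let Y : ι → ℝ := fun m => hypY (P m) (M m) x
  obtain ⟨s, hs, hsL⟩ : ∃ s : ℝ, 1 ≤ s ∧ s ^ 2 = L :=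
    ⟨√L, Real.one_le_sqrt.2 hL, Real.sq_sqrt (by linarith)⟩
  have hs0 : 0 < s := by linarith
  have hup : ∀ m ∈ T, X m ^ 2 + Y m ^ 2 ≤ D * R * s ^ 2 / 2 := fun m hm => by
    have := hypX_sq_add_hypY_sq_le (P := P m) (M := M m) hD hx hxD
    have := mul_le_mul_of_nonneg_left (hN m hm) hD0.le
    simp only [X, Y]; rw [hsL]; linarith
  have hDR : 1 ≤ D * R := one_le_mul_of_one_le_of_one_le hD hR
  -- the larger of the two coordinates is at most a multiple of `s`, the smaller one of `s⁻¹`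
  have main : ∀ a b : ℝ, |a| ≤ |b| → |a * b| ≤ C → a ^ 2 + b ^ 2 ≤ D * R * s ^ 2 / 2 →
      (s = 1 ∨ s ^ 2 ≤ 2 * D * (a ^ 2 + b ^ 2)) →
      |a * s| ≤ 2 * D * C + D * R ∧ |b / s| ≤ 2 * D * C + D * R := by
    intro a b hab hC' hu hl
    have hb : |b| ≤ D * R * s := by
      refine abs_le_of_sq_le_sq ?_ (by positivity)
      nlinarith [sq_nonneg a, mul_le_mul_of_nonneg_right hDR
        (by positivity : 0 ≤ D * R * s ^ 2), (by positivity : 0 ≤ D * R * s ^ 2)]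
    have hDC : 0 ≤ 2 * D * C := by positivity
    refine ⟨?_, ?_⟩
    · rw [abs_mul, abs_of_pos hs0]
      rcases hl with rfl | hl
      · linarith
      · have h1 : a ^ 2 ≤ b ^ 2 := sq_le_sq.2 hab
        have h2 : s ≤ 2 * D * |b| := by
          refine le_of_sq_le_sq ?_ (by positivity)
          rw [mul_pow, sq_abs]
          nlinarith [sq_nonneg b, mul_le_mul_of_nonneg_right hD (mul_nonneg hD0.le (sq_nonneg b))]
        rw [abs_mul] at hC'
        nlinarith [abs_nonneg a, mul_le_mul_of_nonneg_left h2 (abs_nonneg a),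
          mul_le_mul_of_nonneg_left hC' hD0.le]
    · rw [abs_div, abs_of_pos hs0, div_le_iff₀ hs0]
      nlinarith
  have hlow : ∀ m ∈ T, s = 1 ∨ s ^ 2 ≤ 2 * D * (X m ^ 2 + Y m ^ 2) := fun m hm => by
    rcases hN' m hm with h | h
    · left; rw [← hsL] at h; nlinarith
    · right; rw [hsL]; exact h.trans (le_hypX_sq_add_hypY_sq hD hx hxD)
  have hprod : ∀ m ∈ T, |X m * Y m| ≤ C := fun m hm => by
    simp only [X, Y]; rw [hypX_mul_hypY hx0]; exact hf m hm
  have hsep' : ∀ a b : ℝ, |a * s| < η → |b / s| < η →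
      |a * b| < η ^ 2 ∧ 2 * D * (a ^ 2 + b ^ 2) < 4 * D * η ^ 2 * L := by
    intro a b ha hb
    have h1 : |a * b| = |a * s| * |b / s| := by rw [← abs_mul]; congr 1; field_simp
    refine ⟨?_, ?_⟩
    · rw [h1, sq]; exact mul_lt_mul'' ha hb (abs_nonneg _) (abs_nonneg _)
    · have h2 : a ^ 2 ≤ (a * s) ^ 2 := by rw [mul_pow]; nlinarith [sq_nonneg a]
      have h3 : (a * s) ^ 2 < η ^ 2 := sq_lt_sq.2 (by rwa [abs_of_pos hη])
      have h4 : (b / s) ^ 2 < η ^ 2 := sq_lt_sq.2 (by rwa [abs_of_pos hη])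
      have h5 : b ^ 2 = (b / s) ^ 2 * L := by rw [← hsL]; field_simp
      have h6 : b ^ 2 < η ^ 2 * L := by rw [h5]; nlinarith
      have h7 : a ^ 2 + b ^ 2 < 2 * (η ^ 2 * L) := by nlinarith [sq_nonneg η]
      nlinarith
  have hsplit : T ⊆ {m ∈ T | |X m| ≤ |Y m|} ∪ {m ∈ T | |Y m| ≤ |X m|} := fun m hm =>
    (le_total |X m| |Y m|).imp (fun h => ⟨hm, h⟩) (fun h => ⟨hm, h⟩)
  refine (Set.encard_le_encard hsplit).trans ((Set.encard_union_le _ _).trans ?_)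
  push_cast
  refine add_le_add (hK _ (fun m => X m * s) (fun m => Y m / s) ?_ ?_)
    (hK _ (fun m => Y m * s) (fun m => X m / s) ?_ ?_)
  · exact fun m hm => main _ _ hm.2 (hprod m hm.1) (hup m hm.1) (hlow m hm.1)
  · intro m hm m' hm' h1 h2
    rw [← sub_mul] at h1
    rw [← sub_div] at h2
    obtain ⟨h3, h4⟩ := hsep' _ _ h1 h2
    simp only [X, Y, hypX_sub, hypY_sub] at h3 h4
    rw [hypX_mul_hypY hx0] at h3
    exact hsep m hm.1 m' hm'.1 h3 ((le_hypX_sq_add_hypY_sq hD hx hxD).trans_lt h4)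
  · exact fun m hm => main _ _ hm.2 (by rw [mul_comm]; exact hprod m hm.1)
      (by rw [add_comm]; exact hup m hm.1) (by rw [add_comm]; exact hlow m hm.1)
  · intro m hm m' hm' h1 h2
    rw [← sub_mul] at h1
    rw [← sub_div] at h2
    obtain ⟨h3, h4⟩ := hsep' _ _ h1 h2
    rw [mul_comm] at h3
    rw [add_comm (_ ^ 2)] at h4
    simp only [X, Y, hypX_sub, hypY_sub] at h3 h4
    rw [hypX_mul_hypY hx0] at h3
    exact hsep m hm.1 m' hm'.1 h3 ((le_hypX_sq_add_hypY_sq hD hx hxD).trans_lt h4)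

theorem exists_eq_mul_isCoprime {q : ℤ × ℤ} (hq : q ≠ 0) : ∃ (k : ℤ) (q' : ℤ × ℤ),
    1 ≤ k ∧ IsCoprime q'.1 q'.2 ∧ q.1 = k * q'.1 ∧ q.2 = k * q'.2 := by
  have h : 0 < Int.gcd q.1 q.2 := Int.gcd_pos_iff.2 (by
    by_contra! h; exact hq (Prod.ext h.1 h.2))
  obtain ⟨a, b, hab, h1, h2⟩ := Int.exists_gcd_one h
  exact ⟨Int.gcd q.1 q.2, (a, b), by omega, Int.isCoprime_iff_gcd_eq_one.2 hab,
    by rw [mul_comm]; exact h1, by rw [mul_comm]; exact h2⟩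

theorem exists_pow_le_lt_pow {R : ℝ} (hR : 1 < R) (y : ℝ) :
    ∃ n : ℕ, y < R ^ (n + 1) ∧ R ^ n ≤ max 1 y := by
  rcases le_total 1 y with hy | hy
  · obtain ⟨n, h1, h2⟩ := exists_nat_pow_near hy hR
    exact ⟨n, h2, by simp [hy, h1]⟩
  · exact ⟨0, by simpa using hy.trans_lt hR, by simp⟩

/-- The points of `[D⁻¹, D]` at which `hypForm P M` is within `ε` of `b`. -/
def nearSet (D P M b ε : ℝ) : Set ℝ := {σ | D⁻¹ ≤ σ ∧ σ ≤ D ∧ |hypForm P M σ - b| ≤ ε}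

theorem abs_hypForm_sub_le_of_nearSet_inter {D P M b ε x r Q : ℝ} (hD : 1 ≤ D) (hx : D⁻¹ ≤ x)
    (hr : r * (P ^ 2 + M ^ 2) ≤ Q) (h : (nearSet D P M b ε ∩ Set.Icc x (x + r)).Nonempty) :
    |hypForm P M x - b| ≤ ε + D ^ 2 * Q / 4 := by
  obtain ⟨z, ⟨hz, -, hzb⟩, hxz, hzr⟩ := h
  have h1 := abs_hypForm_sub_le (P := P) (M := M) hD hx hz
  have h2 := abs_sub_le (hypForm P M x) (hypForm P M z) b
  have h3 : |x - z| ≤ r := by rw [abs_le]; constructor <;> linarith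
  have h4 : |x - z| * (D ^ 2 * (P ^ 2 + M ^ 2)) ≤ D ^ 2 * Q := by
    calc |x - z| * (D ^ 2 * (P ^ 2 + M ^ 2)) ≤ r * (D ^ 2 * (P ^ 2 + M ^ 2)) := by gcongr
      _ = D ^ 2 * (r * (P ^ 2 + M ^ 2)) := by ring
      _ ≤ _ := by gcongr
  linarith

theorem abs_sub_lt_of_mem_nearSet_zero {D R A ℓ c P M x y : ℝ} {a : ℕ} (hD : 1 ≤ D) (hR : 1 < R)
    (hA : 0 < A) (hℓ : 0 < ℓ) (hc : c = ℓ / (16 * D ^ 2 * A * R)) (ha : R ^ a ≤ A * (P ^ 2 + M ^ 2))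
    (hx : x ∈ nearSet D P M 0 c) (hy : y ∈ nearSet D P M 0 c) : |x - y| < ℓ / R ^ (a + 1) := by
  have hR0 : 0 < R := by linarith
  have hD0 : 0 < D := by linarith
  have hN : 0 < P ^ 2 + M ^ 2 := pos_of_mul_pos_right ((pow_pos hR0 a).trans_le ha) hA.le
  refine abs_sub_lt_of_abs_hypForm_le hD hx.1 hx.2.1 hy.1 hy.2.1 hx.2.2 hy.2.2 hN ?_
  have h1 : 8 * D ^ 2 * c = ℓ / (2 * A * R) := by rw [hc]; field_simp; norm_num
  have h2 : ℓ / (A * R) ≤ ℓ / R ^ (a + 1) * (P ^ 2 + M ^ 2) := by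
    rw [div_mul_eq_mul_div, div_le_div_iff₀ (by positivity) (by positivity), pow_succ]
    have := mul_le_mul_of_nonneg_left ha (mul_nonneg hℓ.le hR0.le)
    linarith
  have h3 : ℓ / (2 * A * R) = ℓ / (A * R) / 2 := by field_simp
  have h4 : 0 < ℓ / (A * R) := by positivity
  linarith

theorem encard_le_four_of_nearSet {α β D R A ℓ c x : ℝ} {n : ℕ} (hD : 1 ≤ D) (hR : 1 < R)
    (hℓ : 0 < ℓ) (hℓD : ℓ ≤ D) (hA : 4 * D ^ 4 * R ^ 2 + 1 ≤ A) (hc : c = ℓ / (16 * D ^ 2 * A * R))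
    (hx : D⁻¹ ≤ x) (hxD : x ≤ D) {T : Set (ℤ × ℤ)} (hT : ∀ q ∈ T, IsCoprime q.1 q.2)
    (hl : ∀ q ∈ T, R ^ n ≤ A * ((q.1 + α * q.2) ^ 2 + (β * q.1 + (β * α - 2) * q.2) ^ 2))
    (hh : ∀ q ∈ T, A * ((q.1 + α * q.2) ^ 2 + (β * q.1 + (β * α - 2) * q.2) ^ 2) < R ^ (n + 1))
    (hne : ∀ q ∈ T, (nearSet D (q.1 + α * q.2) (β * q.1 + (β * α - 2) * q.2) 0 c ∩
      Set.Icc x (x + ℓ / R ^ n)).Nonempty) : T.encard ≤ 4 := by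
  have hR0 : 0 < R := by linarith
  have hD0 : 0 < D := by linarith
  have hA0 : 0 < A := lt_of_lt_of_le (by positivity) hA
  refine encard_le_four_of_abs_hypForm_le (α := α) (β := β) (R := R) (L := R ^ n / A) (μ := c + D ^ 2 * (ℓ * R / A) / 4)
    hD hR.le (by positivity) ?_ hx hxD hT ?_ ?_ ?_
  · have h1 : 4 * c * D * R ≤ 1 / 4 := by
      rw [hc, show 4 * (ℓ / (16 * D ^ 2 * A * R)) * D * R = ℓ / (4 * D * A) by field_simp; norm_num,
        div_le_div_iff₀ (by positivity) (by norm_num)]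
      have : 1 ≤ A := le_trans (by nlinarith [(by positivity : 0 < D ^ 4 * R ^ 2)]) hA
      nlinarith
    have h2 : 4 * (D ^ 2 * (ℓ * R / A) / 4) * D * R ≤ 1 / 4 := by
      rw [show 4 * (D ^ 2 * (ℓ * R / A) / 4) * D * R = D ^ 3 * R ^ 2 * ℓ / A by field_simp,
        div_le_div_iff₀ (by positivity) (by norm_num)]
      nlinarith [mul_le_mul_of_nonneg_left hℓD (by positivity : 0 ≤ D ^ 3 * R ^ 2)]
    linarith
  · intro q hq
    rw [div_le_iff₀ hA0, mul_comm]; exact hl q hq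
  · intro q hq
    rw [mul_div_assoc', le_div_iff₀ hA0, mul_comm, ← pow_succ']; exact (hh q hq).le
  · intro q hq
    have := abs_hypForm_sub_le_of_nearSet_inter (Q := ℓ * R / A) hD hx ?_ (hne q hq)
    · rwa [sub_zero] at this
    · rw [div_mul_eq_mul_div, div_le_div_iff₀ (by positivity) hA0]
      have := mul_le_mul_of_nonneg_left (hh q hq).le hℓ.le
      rw [pow_succ R] at this
      linarith

theorem mul_pow_le_of_nearSet_nonempty {D R P M b ε ν : ℝ} {a : ℕ} (hD : 1 ≤ D)
    (hε : ε ≤ |b| / 2) (hν0 : 0 < ν) (hν1 : ν ≤ 1) (hν : ν ≤ 2 * |b| / D)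
    (ha : R ^ a ≤ max 1 (P ^ 2 + M ^ 2)) (hne : (nearSet D P M b ε).Nonempty) :
    ν * R ^ a ≤ P ^ 2 + M ^ 2 := by
  obtain ⟨z, hz, hzD, hzb⟩ := hne
  have hD0 : 0 < D := by linarith
  have h1 := abs_hypForm_le (P := P) (M := M) hD hz hzD
  have h2 : |b| - |hypForm P M z| ≤ |hypForm P M z - b| := by
    rw [abs_sub_comm]; exact abs_sub_abs_le_abs_sub _ _
  have h3 : ν ≤ P ^ 2 + M ^ 2 := by
    refine hν.trans ?_
    rw [div_le_iff₀ hD0]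
    linarith
  rcases le_max_iff.1 ha with h | h
  · nlinarith
  · nlinarith

theorem abs_sub_lt_of_mem_nearSet {D R ℓ P M b ε ν x y : ℝ} {a d : ℕ} (hD : 1 ≤ D) (hR : 1 < R)
    (hℓ : 0 < ℓ) (hε : ε ≤ |b| / 2) (hε' : ε ≤ ℓ * ν / (16 * D ^ 2 * R ^ d))
    (hν0 : 0 < ν) (hν1 : ν ≤ 1) (hν : ν ≤ 2 * |b| / D) (ha : R ^ a ≤ max 1 (P ^ 2 + M ^ 2))
    (hx : x ∈ nearSet D P M b ε) (hy : y ∈ nearSet D P M b ε) : |x - y| < ℓ / R ^ (a + d) := by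
  have hR0 : 0 < R := by linarith
  have hD0 : 0 < D := by linarith
  have hN := mul_pow_le_of_nearSet_nonempty hD hε hν0 hν1 hν ha ⟨x, hx⟩
  refine abs_sub_lt_of_abs_hypForm_le hD hx.1 hx.2.1 hy.1 hy.2.1 hx.2.2 hy.2.2
    ((by positivity : 0 < ν * R ^ a).trans_le hN) ?_
  have h1 : 8 * D ^ 2 * ε ≤ ℓ * ν / R ^ d / 2 := by
    calc 8 * D ^ 2 * ε ≤ 8 * D ^ 2 * (ℓ * ν / (16 * D ^ 2 * R ^ d)) := by gcongr
      _ = _ := by field_simp; norm_num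
  have h2 : ℓ * ν / R ^ d ≤ ℓ / R ^ (a + d) * (P ^ 2 + M ^ 2) := by
    calc ℓ * ν / R ^ d = ℓ / R ^ (a + d) * (ν * R ^ a) := by rw [pow_add]; field_simp
      _ ≤ _ := by gcongr
  have h3 : 0 < ℓ * ν / R ^ d := by positivity
  linarith

theorem exists_encard_le_of_nearSet {α β γ δ D R A ℓ c b : ℝ} (hD : 1 ≤ D) (hR : 1 < R)
    (hA : 0 < A) (hℓ : 0 < ℓ) (hℓD : ℓ ≤ D) (hc : c = ℓ / (16 * D ^ 2 * A * R)) :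
    ∃ K : ℕ, ∀ (n : ℕ) (x ε : ℝ) (T : Set (ℤ × ℤ)), ε ≤ |b| → D⁻¹ ≤ x → x ≤ D →
      (∀ q : ℤ × ℤ, IsCoprime q.1 q.2 →
        A * ((q.1 + α * q.2) ^ 2 + (β * q.1 + (β * α - 2) * q.2) ^ 2) < R ^ n →
        c < |hypForm (q.1 + α * q.2) (β * q.1 + (β * α - 2) * q.2) x|) →
      (∀ m ∈ T, (m.1 + α * m.2 + γ) ^ 2 + (β * m.1 + (β * α - 2) * m.2 + δ) ^ 2 < R ^ (n + 1)) →
      (∀ m ∈ T, R ^ n ≤ max 1 ((m.1 + α * m.2 + γ) ^ 2 + (β * m.1 + (β * α - 2) * m.2 + δ) ^ 2)) →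
      (∀ m ∈ T, (nearSet D (m.1 + α * m.2 + γ) (β * m.1 + (β * α - 2) * m.2 + δ) b ε ∩
        Set.Icc x (x + ℓ / R ^ n)).Nonempty) → T.encard ≤ K := by
  have hR0 : 0 < R := by linarith
  have hD0 : 0 < D := by linarith
  have hc0 : 0 < c := by rw [hc]; positivity
  obtain ⟨K, hK⟩ := exists_encard_le_of_abs_hypForm_le (C := 2 * |b| + D ^ 2 * (ℓ * R)) (D := D)
    (R := R) (Real.sqrt_pos.2 hc0) (by positivity) hD hR.le
  rw [Real.sq_sqrt hc0.le] at hK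
  refine ⟨K, fun n x ε T hε hx hxD hdue hh hl hne => ?_⟩
  refine hK T (fun m => m.1 + α * m.2 + γ) (fun m => β * m.1 + (β * α - 2) * m.2 + δ) (R ^ n) x
    (one_le_pow₀ hR.le) hx hxD ?_ ?_ ?_ ?_
  · intro m hm
    have h1 := abs_hypForm_sub_le_of_nearSet_inter (Q := ℓ * R) hD hx ?_ (hne m hm)
    · have h2 := abs_sub_abs_le_abs_sub
        (hypForm (m.1 + α * m.2 + γ) (β * m.1 + (β * α - 2) * m.2 + δ) x) b
      have h3 : 0 < D ^ 2 * (ℓ * R) := by positivity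
      linarith
    · rw [div_mul_eq_mul_div, div_le_iff₀ (by positivity)]
      have := mul_le_mul_of_nonneg_left (hh m hm).le hℓ.le
      rw [pow_succ R] at this
      linarith
  · intro m hm
    rw [← pow_succ']; exact (hh m hm).le
  · intro m hm
    rcases le_max_iff.1 (hl m hm) with h | h
    · exact Or.inl (le_antisymm h (one_le_pow₀ hR.le))
    · exact Or.inr h
  · intro m _ m' _ hf hN
    by_contra hmm
    obtain ⟨k, q, hk, hq, h1, h2⟩ := exists_eq_mul_isCoprime (sub_ne_zero.2 hmm)
    have h1' : (m.1 : ℝ) - m'.1 = k * q.1 := by exact_mod_cast h1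
    have h2' : (m.2 : ℝ) - m'.2 = k * q.2 := by exact_mod_cast h2
    have hP : m.1 + α * m.2 + γ - (m'.1 + α * m'.2 + γ) = k * (q.1 + α * q.2) := by
      linear_combination h1' + α * h2'
    have hM : β * m.1 + (β * α - 2) * m.2 + δ - (β * m'.1 + (β * α - 2) * m'.2 + δ) =
        k * (β * q.1 + (β * α - 2) * q.2) := by
      linear_combination β * h1' + (β * α - 2) * h2'
    have hk1 : (1 : ℝ) ≤ (k : ℝ) ^ 2 := one_le_pow₀ (by exact_mod_cast hk)
    simp only [hP, hM] at hf hN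
    rw [hypForm_mul, abs_mul, abs_of_nonneg (sq_nonneg _)] at hf
    rw [mul_pow, mul_pow, ← mul_add] at hN
    have hf' := le_mul_of_one_le_left (abs_nonneg
      (hypForm (q.1 + α * q.2) (β * q.1 + (β * α - 2) * q.2) x)) hk1
    refine absurd (hdue q hq ?_) (hf'.trans hf.le).not_gt
    have hN' := le_mul_of_one_le_left (add_nonneg (sq_nonneg ((q.1 : ℝ) + α * q.2))
      (sq_nonneg (β * q.1 + (β * α - 2) * q.2))) hk1
    calc A * _ < A * (4 * D * c * R ^ n) := by gcongr; exact hN'.trans_lt hN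
      _ = ℓ / (4 * D * R) * R ^ n := by rw [hc]; field_simp; norm_num
      _ ≤ 1 * R ^ n := by
          gcongr
          rw [div_le_one (by positivity)]
          nlinarith
      _ = _ := one_mul _

theorem ENNReal.tsum_indicator_const {ι : Type*} (S : Set ι) (w : ENNReal) :
    ∑' i, S.indicator (fun _ => w) i = S.encard * w := by
  rw [← tsum_subtype S (fun _ => w), ENNReal.tsum_set_const]

open Filter Topology in
theorem exists_nat_mul_inv_pow_le {ρ : ℕ} (hρ : 2 ≤ ρ) (K : ℕ) {w : ENNReal} (hw : 0 < w) :
    ∃ d : ℕ, 1 ≤ d ∧ (K : ENNReal) * ((ρ : ENNReal)⁻¹) ^ d ≤ w := by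
  have h : Tendsto (fun d : ℕ => (K : ENNReal) * ((ρ : ENNReal)⁻¹) ^ d) atTop (𝓝 (K * 0)) := by
    refine ENNReal.Tendsto.const_mul (ENNReal.tendsto_pow_atTop_nhds_zero_of_lt_one ?_)
      (Or.inr (ENNReal.natCast_ne_top K))
    rw [ENNReal.inv_lt_one]
    exact_mod_cast hρ
  rw [mul_zero] at h
  obtain ⟨d, h1, h2⟩ := ((h.eventually (gt_mem_nhds hw)).and (eventually_ge_atTop 1)).exists
  exact ⟨d, h2, h1.le⟩

theorem ofReal_le_dimH_hypForm {B : Set ℝ} (hB : B.Countable) (h0 : (0 : ℝ) ∉ B) (α β γ δ : ℝ)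
    {s₀ ℓ : ℝ} (hs : 0 < s₀) (hℓ : 0 < ℓ) {ρ : ℕ} (hρ : 32 ≤ ρ) :
    ENNReal.ofReal (Real.log (2 * ρ) / Real.log (8 * ρ)) ≤
      dimH {σ : ℝ | σ ∈ Set.Icc s₀ (s₀ + ℓ) ∧ ∀ b ∈ B, ∃ ε > 0, ∀ m : ℤ × ℤ,
        ε < |hypForm (m.1 + α * m.2 + γ) (β * m.1 + (β * α - 2) * m.2 + δ) σ - b|} := by
  have hBc : Countable B := hB.to_subtype
  set R : ℝ := 8 * ρ with hRdef
  have hρ' : (32 : ℝ) ≤ ρ := by exact_mod_cast hρ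
  have hR : 1 < R := by linarith
  have hR0 : 0 < R := by linarith
  obtain ⟨D, hD, hℓD, hDs, hsD⟩ : ∃ D : ℝ, 1 ≤ D ∧ ℓ ≤ D ∧ D⁻¹ ≤ s₀ ∧ s₀ + ℓ ≤ D := by
    have : 0 < s₀⁻¹ := inv_pos.2 hs
    refine ⟨1 + s₀⁻¹ + s₀ + ℓ, by linarith, by linarith, inv_le_of_inv_le₀ hs (by linarith),
      by linarith⟩
  have hD0 : 0 < D := by linarith
  obtain ⟨A, hA, hAβ⟩ : ∃ A : ℝ, 4 * D ^ 4 * R ^ 2 + 1 ≤ A ∧ 1 + β ^ 2 ≤ A :=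
    ⟨4 * D ^ 4 * R ^ 2 + (1 + β ^ 2), by linarith [sq_nonneg β],
      by linarith [(by positivity : 0 < 4 * D ^ 4 * R ^ 2)]⟩
  have hA0 : 0 < A := lt_of_lt_of_le (by positivity) hA
  obtain ⟨c, hc⟩ : ∃ c : ℝ, c = ℓ / (16 * D ^ 2 * A * R) := ⟨_, rfl⟩
  have hc0 : 0 < c := by rw [hc]; positivity
  choose lev hlev hlev' using exists_pow_le_lt_pow hR
  have hNq : ∀ q : ℤ × ℤ, IsCoprime q.1 q.2 →
      1 ≤ A * ((q.1 + α * q.2) ^ 2 + (β * q.1 + (β * α - 2) * q.2) ^ 2) := fun q hq => by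
    have hq0 : q ≠ 0 := by
      rintro rfl
      exact not_isCoprime_zero_zero hq
    refine (one_le_mul_sq_add_sq (α := α) (β := β) hq0).trans ?_
    gcongr
  have hcount := fun b : B => exists_encard_le_of_nearSet (α := α) (β := β) (γ := γ) (δ := δ)
    (b := b) hD hR hA0 hℓ hℓD hc
  choose K hK using hcount
  obtain ⟨w, hw, hwsum⟩ := ENNReal.exists_pos_sum_of_countable' (ε := 1 / 8) (by simp) B
  choose d hd hdw using fun b : B => exists_nat_mul_inv_pow_le (by omega : 2 ≤ ρ) (K b) (hw b)
  have hb0 : ∀ b : B, 0 < |(b : ℝ)| := fun b => abs_pos.2 fun h => h0 (h ▸ b.2)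
  let ν : B → ℝ := fun b => min 1 (2 * |(b : ℝ)| / D)
  have hν0 : ∀ b, 0 < ν b := fun b => lt_min one_pos (div_pos (by linarith [hb0 b]) hD0)
  let ε : B → ℝ := fun b => min (|(b : ℝ)| / 2) (ℓ * ν b / (16 * D ^ 2 * R ^ d b))
  have hε0 : ∀ b, 0 < ε b := fun b => lt_min (by linarith [hb0 b])
    (div_pos (mul_pos hℓ (hν0 b)) (by positivity))
  let J := {q : ℤ × ℤ // IsCoprime q.1 q.2} ⊕ (B × (ℤ × ℤ))
  let Z : J → Set ℝ := Sum.elim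
    (fun q => nearSet D (q.1.1 + α * q.1.2) (β * q.1.1 + (β * α - 2) * q.1.2) 0 c)
    (fun j => nearSet D (j.2.1 + α * j.2.2 + γ) (β * j.2.1 + (β * α - 2) * j.2.2 + δ) j.1 (ε j.1))
  let a : J → ℕ := Sum.elim
    (fun q => lev (A * ((q.1.1 + α * q.1.2) ^ 2 + (β * q.1.1 + (β * α - 2) * q.1.2) ^ 2)))
    (fun j => lev ((j.2.1 + α * j.2.2 + γ) ^ 2 + (β * j.2.1 + (β * α - 2) * j.2.2 + δ) ^ 2))
  let e : J → ℕ := Sum.elim (fun _ => 1) (fun j => d j.1)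
  have hlevq : ∀ q : {q : ℤ × ℤ // IsCoprime q.1 q.2}, R ^ a (Sum.inl q) ≤
      A * ((q.1.1 + α * q.1.2) ^ 2 + (β * q.1.1 + (β * α - 2) * q.1.2) ^ 2) := fun q => by
    have := hlev' (A * ((q.1.1 + α * q.1.2) ^ 2 + (β * q.1.1 + (β * α - 2) * q.1.2) ^ 2))
    rwa [max_eq_right (hNq q.1 q.2)] at this
  have main := le_dimH_avoiding (by omega : 1 ≤ ρ) (s₀ := s₀) hℓ Z a e ?_ ?_ ?_
  · refine main.trans (dimH_mono ?_)
    rintro y ⟨hy, hyZ⟩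
    refine ⟨hy, fun b hb => ⟨ε ⟨b, hb⟩, hε0 _, fun m => ?_⟩⟩
    by_contra! h
    exact hyZ (Sum.inr (⟨b, hb⟩, m)) ⟨hDs.trans hy.1, hy.2.trans hsD, h⟩
  · rintro (q | j)
    · exact le_rfl
    · exact hd j.1
  · rintro (q | j) x hx y hy
    · exact abs_sub_lt_of_mem_nearSet_zero hD hR hA0 hℓ hc (hlevq q) hx hy
    · exact abs_sub_lt_of_mem_nearSet hD hR hℓ (min_le_left _ _) (min_le_right _ _) (hν0 j.1)
        (min_le_left _ _) (min_le_right _ _) (hlev' _) hx hy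
  · intro n x hsx hxs hold
    rw [← hRdef] at hxs hold ⊢
    have hx : D⁻¹ ≤ x := hDs.trans hsx
    have hr : 0 < ℓ / R ^ n := by positivity
    have hxD : x ≤ D := by linarith
    have hdue : ∀ q : ℤ × ℤ, IsCoprime q.1 q.2 →
        A * ((q.1 + α * q.2) ^ 2 + (β * q.1 + (β * α - 2) * q.2) ^ 2) < R ^ n →
        c < |hypForm (q.1 + α * q.2) (β * q.1 + (β * α - 2) * q.2) x| := by
      intro q hq hlt
      by_contra! h
      have h1 : a (Sum.inl ⟨q, hq⟩) < n :=
        (pow_lt_pow_iff_right₀ hR).1 ((hlevq ⟨q, hq⟩).trans_lt hlt)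
      exact hold (Sum.inl ⟨q, hq⟩) h1
        ⟨x, ⟨hx, hxD, by rwa [sub_zero]⟩, le_rfl, by linarith⟩
    rw [Summable.tsum_sum ENNReal.summable ENNReal.summable]
    have hleft : ∑' q, Set.indicator {j | a j = n ∧ (Z j ∩ Set.Icc x (x + ℓ / R ^ n)).Nonempty}
        (fun j => ((ρ : ENNReal)⁻¹) ^ e j) (Sum.inl q) ≤ 1 / 8 := by
      let T : Set {q : ℤ × ℤ // IsCoprime q.1 q.2} :=
        {q | a (Sum.inl q) = n ∧ (Z (Sum.inl q) ∩ Set.Icc x (x + ℓ / R ^ n)).Nonempty}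
      have hT : T.encard ≤ 4 := by
        rw [← Subtype.val_injective.encard_image]
        refine encard_le_four_of_nearSet (α := α) (β := β) (n := n) hD hR hℓ hℓD hA hc hx hxD
          ?_ ?_ ?_ ?_
        · rintro _ ⟨q, -, rfl⟩
          exact q.2
        · rintro _ ⟨q, ⟨hq, -⟩, rfl⟩
          rw [← hq]; exact hlevq q
        · rintro _ ⟨q, ⟨hq, -⟩, rfl⟩
          rw [← hq]; exact hlev _
        · rintro _ ⟨q, ⟨-, hq⟩, rfl⟩
          exact hq
      calc _ = ∑' q, T.indicator (fun _ => (ρ : ENNReal)⁻¹ ^ 1) q := rfl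
        _ = T.encard * (ρ : ENNReal)⁻¹ := by rw [ENNReal.tsum_indicator_const, pow_one]
        _ ≤ 4 * (32 : ENNReal)⁻¹ := by
            gcongr
            · exact_mod_cast hT
            · exact_mod_cast hρ
        _ = 1 / 8 := by
            rw [show (32 : ENNReal) = 4 * 8 by norm_num,
              ENNReal.mul_inv (by simp) (by simp), ← mul_assoc,
              ENNReal.mul_inv_cancel (by simp) (by simp), one_mul, one_div]
    have hright : ∑' j, Set.indicator {j | a j = n ∧ (Z j ∩ Set.Icc x (x + ℓ / R ^ n)).Nonempty}
        (fun j => ((ρ : ENNReal)⁻¹) ^ e j) (Sum.inr j) ≤ 1 / 8 := by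
      rw [ENNReal.tsum_prod']
      refine le_trans (ENNReal.tsum_le_tsum fun b => ?_) hwsum.le
      let T : Set (ℤ × ℤ) := {m | a (Sum.inr (b, m)) = n ∧
        (Z (Sum.inr (b, m)) ∩ Set.Icc x (x + ℓ / R ^ n)).Nonempty}
      have hT : T.encard ≤ K b := by
        refine hK b n x (ε b) T ((min_le_left _ _).trans (by linarith [hb0 b])) hx hxD hdue ?_ ?_ ?_
        · rintro m ⟨hm, -⟩
          rw [← hm]; exact hlev _
        · rintro m ⟨hm, -⟩
          rw [← hm]; exact hlev' _
        · rintro m ⟨-, hm⟩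
          exact hm
      calc _ = ∑' m, T.indicator (fun _ => ((ρ : ENNReal)⁻¹) ^ d b) m := rfl
        _ = T.encard * ((ρ : ENNReal)⁻¹) ^ d b := ENNReal.tsum_indicator_const _ _
        _ ≤ K b * ((ρ : ENNReal)⁻¹) ^ d b := by
            gcongr
            exact_mod_cast hT
        _ ≤ w b := hdw b
    refine (add_le_add hleft hright).trans (le_of_eq ?_)
    rw [← ENNReal.add_div, show (1 + 1 : ENNReal) / 8 = 2 / (2 * 4) by norm_num,
      ← ENNReal.mul_div_mul_left 1 4 (by simp : (2 : ENNReal) ≠ 0) (by simp), mul_one]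

open Filter Topology in
theorem one_le_dimH_hypForm {B : Set ℝ} (hB : B.Countable) (h0 : (0 : ℝ) ∉ B) (α β γ δ : ℝ)
    {s₀ ℓ : ℝ} (hs : 0 < s₀) (hℓ : 0 < ℓ) :
    1 ≤ dimH {σ : ℝ | σ ∈ Set.Icc s₀ (s₀ + ℓ) ∧ ∀ b ∈ B, ∃ ε > 0, ∀ m : ℤ × ℤ,
        ε < |hypForm (m.1 + α * m.2 + γ) (β * m.1 + (β * α - 2) * m.2 + δ) σ - b|} := by
  have hlim : Tendsto (fun ρ : ℕ => Real.log (2 * ρ) / Real.log (8 * ρ)) atTop (𝓝 1) := by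
    have h1 : Tendsto (fun ρ : ℕ => Real.log (8 * ρ)) atTop atTop :=
      Real.tendsto_log_atTop.comp
        (tendsto_natCast_atTop_atTop.const_mul_atTop (by norm_num : (0 : ℝ) < 8))
    have h2 : Tendsto (fun ρ : ℕ => 1 - Real.log 4 / Real.log (8 * ρ)) atTop (𝓝 (1 - 0)) :=
      tendsto_const_nhds.sub (h1.const_div_atTop _)
    rw [sub_zero] at h2
    refine h2.congr' ?_
    filter_upwards [eventually_ge_atTop 1] with ρ hρ
    have hρ' : (1 : ℝ) ≤ ρ := by exact_mod_cast hρ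
    have h3 : 0 < Real.log (8 * ρ) := Real.log_pos (by linarith)
    have h4 : Real.log (8 * ρ) = Real.log 4 + Real.log (2 * ρ) := by
      rw [← Real.log_mul (by norm_num) (by positivity)]
      congr 1; ring
    rw [eq_div_iff h3.ne', sub_mul, div_mul_cancel₀ _ h3.ne', h4]
    ring
  have hlim' := (ENNReal.continuous_ofReal.tendsto 1).comp hlim
  rw [ENNReal.ofReal_one] at hlim'
  refine le_of_tendsto hlim' ?_
  filter_upwards [eventually_ge_atTop 32] with ρ hρ
  exact ofReal_le_dimH_hypForm hB h0 α β γ δ hs hℓ hρ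

theorem dimH_image_le_of_contDiffAt {E F : Type*} [NormedAddCommGroup E] [NormedSpace ℝ E]
    [FiniteDimensional ℝ E] [NormedAddCommGroup F] [NormedSpace ℝ F] {f : E → F} {s : Set E}
    (hf : ∀ x ∈ s, ContDiffAt ℝ 1 f x) : dimH (f '' s) ≤ dimH s := by
  have : ProperSpace E := FiniteDimensional.proper_real E
  refine dimH_image_le_of_locally_lipschitzOn fun x hx => ?_
  obtain ⟨K, t, ht, hK⟩ := (hf x hx).exists_lipschitzOnWith
  exact ⟨K, t, mem_nhdsWithin_of_mem_nhds ht, hK⟩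

theorem dimH_setOf_isSL2_le :
    dimH {p : (Fin 2 → Fin 2 → ℝ) × (Fin 2 → ℝ) | isSL2 p.1} ≤ 5 := by
  let f : (Fin 5 → ℝ) → (Fin 2 → Fin 2 → ℝ) × (Fin 2 → ℝ) := fun v =>
    (![![v 0, v 1], ![v 2, (1 + v 1 * v 2) / v 0]], ![v 3, v 4])
  let f' : (Fin 5 → ℝ) → (Fin 2 → Fin 2 → ℝ) × (Fin 2 → ℝ) := fun v =>
    (![![v 1, v 0], ![(v 1 * v 2 - 1) / v 0, v 2]], ![v 3, v 4])
  have hcover : {p : (Fin 2 → Fin 2 → ℝ) × (Fin 2 → ℝ) | isSL2 p.1} ⊆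
      f '' {v | v 0 ≠ 0} ∪ f' '' {v | v 0 ≠ 0} := by
    rintro ⟨g, w⟩ (h : g 0 0 * g 1 1 - g 0 1 * g 1 0 = 1)
    by_cases h0 : g 0 0 = 0
    · have h1 : g 0 1 ≠ 0 := by rintro h1; simp [h0, h1] at h
      refine Or.inr ⟨![g 0 1, g 0 0, g 1 1, w 0, w 1], h1, ?_⟩
      have h2 : (g 0 0 * g 1 1 - 1) / g 0 1 = g 1 0 := by
        rw [div_eq_iff h1]; linarith
      refine Prod.ext (funext fun i => funext fun j => ?_) (funext fun i => ?_)
      · fin_cases i <;> fin_cases j <;> simp [f', h2]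
      · fin_cases i <;> simp [f']
    · refine Or.inl ⟨![g 0 0, g 0 1, g 1 0, w 0, w 1], h0, ?_⟩
      have h2 : (1 + g 0 1 * g 1 0) / g 0 0 = g 1 1 := by
        rw [div_eq_iff h0]; linarith
      refine Prod.ext (funext fun i => funext fun j => ?_) (funext fun i => ?_)
      · fin_cases i <;> fin_cases j <;> simp [f, h2]
      · fin_cases i <;> simp [f]
  have hdim : dimH {v : Fin 5 → ℝ | v 0 ≠ 0} ≤ 5 :=
    (dimH_mono (Set.subset_univ _)).trans (by rw [Real.dimH_univ_pi_fin]; norm_num)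
  refine (dimH_mono hcover).trans ?_
  rw [dimH_union]
  refine max_le ((dimH_image_le_of_contDiffAt fun v hv => ?_).trans hdim)
    ((dimH_image_le_of_contDiffAt fun v hv => ?_).trans hdim) <;> change v 0 ≠ 0 at hv
  · refine ContDiffAt.prodMk (contDiffAt_pi.2 fun i => contDiffAt_pi.2 fun j => ?_)
      (contDiffAt_pi.2 fun i => ?_)
    · fin_cases i <;> fin_cases j <;> simp <;> fun_prop (disch := assumption)
    · fin_cases i <;> simp <;> fun_prop
  · refine ContDiffAt.prodMk (contDiffAt_pi.2 fun i => contDiffAt_pi.2 fun j => ?_)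
      (contDiffAt_pi.2 fun i => ?_)
    · fin_cases i <;> fin_cases j <;> simp <;> fun_prop (disch := assumption)
    · fin_cases i <;> simp <;> fun_prop

open Filter Topology in
/-- Near any element of `SL(2, ℝ)` there is one with nonzero sum of the entries in its first
column. -/
theorem exists_isSL2_add_ne_zero {U : Set ((Fin 2 → Fin 2 → ℝ) × (Fin 2 → ℝ))} (hU : IsOpen U)
    (h : (U ∩ {p | isSL2 p.1}).Nonempty) :
    ∃ p ∈ U, isSL2 p.1 ∧ p.1 0 0 + p.1 1 0 ≠ 0 := by
  obtain ⟨⟨g, w⟩, hgU, hg⟩ := h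
  by_cases hne : g 0 0 + g 1 0 = 0
  · have h00 : g 0 0 ≠ 0 := by
      rintro h0
      have h1 : g 1 0 = 0 := by linarith
      simp [isSL2, h0, h1] at hg
    let φ : ℝ → (Fin 2 → Fin 2 → ℝ) × (Fin 2 → ℝ) := fun r =>
      (![![r * g 0 0, r * g 0 1], ![r⁻¹ * g 1 0, r⁻¹ * g 1 1]], w)
    have hφ1 : φ 1 = (g, w) := by
      refine Prod.ext (funext fun i => funext fun j => ?_) rfl
      fin_cases i <;> fin_cases j <;> simp [φ]
    have hφ : ContinuousAt φ 1 := by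
      refine ContinuousAt.prodMk (continuousAt_pi.2 fun i => continuousAt_pi.2 fun j => ?_)
        continuousAt_const
      have : (1 : ℝ) ≠ 0 := one_ne_zero
      fin_cases i <;> fin_cases j <;> simp <;> fun_prop (disch := assumption)
    have hev : ∀ᶠ r in 𝓝[>] (1 : ℝ), φ r ∈ U :=
      (hφ.eventually (hU.mem_nhds (hφ1 ▸ hgU))).filter_mono nhdsWithin_le_nhds
    obtain ⟨r, hrU, hr⟩ := (hev.and self_mem_nhdsWithin).exists
    have hr0 : r ≠ 0 := by linarith
    refine ⟨φ r, hrU, ?_, ?_⟩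
    · simp only [isSL2, φ, Matrix.cons_val_zero, Matrix.cons_val_one]
      have hdet : g 0 0 * g 1 1 - g 0 1 * g 1 0 = 1 := hg
      field_simp
      linarith
    · simp only [φ, Matrix.cons_val_zero, Matrix.cons_val_one]
      rw [show g 1 0 = -g 0 0 by linarith]
      intro h
      field_simp at h
      have : g 0 0 * (r ^ 2 - 1) = 0 := by linarith
      rcases mul_eq_zero.1 this with h | h
      · exact h00 h
      · nlinarith
  · exact ⟨(g, w), hgU, hg, hne⟩

/-- Coordinates on the part of `SL(2, ℝ) × ℝ²` where the first column of the matrix has nonzero sum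
of entries. -/
noncomputable def toChart (p : (Fin 2 → Fin 2 → ℝ) × (Fin 2 → ℝ)) : (Fin 4 → ℝ) × ℝ :=
  (![(p.1 0 1 + p.1 1 1) / (p.1 0 0 + p.1 1 0), (p.2 0 + p.2 1) / (p.1 0 0 + p.1 1 0),
    (p.1 0 0 + p.1 1 0) * (p.1 0 0 - p.1 1 0), (p.1 0 0 + p.1 1 0) * (p.2 0 - p.2 1)],
    (p.1 0 0 + p.1 1 0) ^ 2)

/-- The inverse of `toChart`, with `r` a square root of the last coordinate. -/
noncomputable def ofChart (t : Fin 4 → ℝ) (r : ℝ) : (Fin 2 → Fin 2 → ℝ) × (Fin 2 → ℝ) :=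
  (![![(r + t 2 / r) / 2, (t 0 * r + (t 2 * t 0 - 2) / r) / 2],
     ![(r - t 2 / r) / 2, (t 0 * r - (t 2 * t 0 - 2) / r) / 2]],
   ![(t 1 * r + t 3 / r) / 2, (t 1 * r - t 3 / r) / 2])

theorem isSL2_ofChart (t : Fin 4 → ℝ) {r : ℝ} (hr : r ≠ 0) : isSL2 (ofChart t r).1 := by
  simp only [isSL2, ofChart, Matrix.cons_val_zero, Matrix.cons_val_one]
  field_simp
  ring

theorem toChart_ofChart (t : Fin 4 → ℝ) {r : ℝ} (hr : r ≠ 0) :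
    toChart (ofChart t r) = (t, r ^ 2) := by
  simp only [toChart, ofChart, Matrix.cons_val_zero, Matrix.cons_val_one]
  refine Prod.ext (funext fun i => ?_) ?_
  · fin_cases i <;> simp <;> field_simp <;> ring
  · simp only
    ring

theorem ofChart_toChart {p : (Fin 2 → Fin 2 → ℝ) × (Fin 2 → ℝ)} (hp : isSL2 p.1)
    (hne : p.1 0 0 + p.1 1 0 ≠ 0) : ofChart (toChart p).1 (p.1 0 0 + p.1 1 0) = p := by
  obtain ⟨g, w⟩ := p
  simp only [isSL2] at hp hne ⊢
  have h1 : ((g 0 0 + g 1 0) * (g 0 0 - g 1 0) * ((g 0 1 + g 1 1) / (g 0 0 + g 1 0)) - 2) /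
      (g 0 0 + g 1 0) = g 0 1 - g 1 1 := by
    field_simp
    linear_combination 2 * hp
  refine Prod.ext (funext fun i => funext fun j => ?_) (funext fun i => ?_)
  · fin_cases i <;> fin_cases j <;> simp [ofChart, toChart, h1, hne]
  · fin_cases i <;> simp [ofChart, toChart, hne]

theorem affValSet_ofChart_eq (t : Fin 4 → ℝ) {r : ℝ} (hr : r ≠ 0) :
    affValSet (ofChart t r).1 (ofChart t r).2 = Set.range fun m : ℤ × ℤ =>
      hypForm (m.1 + t 0 * m.2 + t 1) (t 2 * m.1 + (t 2 * t 0 - 2) * m.2 + t 3) (r ^ 2) := by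
  have key : ∀ m : ℤ × ℤ,
      hypForm (m.1 + t 0 * m.2 + t 1) (t 2 * m.1 + (t 2 * t 0 - 2) * m.2 + t 3) (r ^ 2) =
      ((ofChart t r).1 0 0 * m.1 + (ofChart t r).1 0 1 * m.2 + (ofChart t r).2 0) *
      ((ofChart t r).1 1 0 * m.1 + (ofChart t r).1 1 1 * m.2 + (ofChart t r).2 1) := by
    intro m
    simp only [hypForm, ofChart, Matrix.cons_val_zero, Matrix.cons_val_one]
    field_simp
    ring
  ext v
  constructor
  · rintro ⟨m₁, m₂, rfl⟩
    exact ⟨(m₁, m₂), key _⟩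
  · rintro ⟨m, rfl⟩
    exact ⟨m.1, m.2, key m⟩

theorem notMem_closure_of_lt_abs_sub {ι : Type*} {f : ι → ℝ} {b ε : ℝ} (hε : 0 < ε)
    (h : ∀ m, ε < |f m - b|) : b ∉ closure (Set.range f) := by
  intro hb
  obtain ⟨_, ⟨m, rfl⟩, hm⟩ := Metric.mem_closure_iff.1 hb ε hε
  rw [dist_comm, Real.dist_eq] at hm
  exact (h m).not_gt hm

open MeasureTheory Measure Filter Topology in
theorem five_le_dimH_of_isOpen {B : Set ℝ} (hB : B.Countable) (h0 : (0 : ℝ) ∉ B)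
    {U : Set ((Fin 2 → Fin 2 → ℝ) × (Fin 2 → ℝ))} (hU : IsOpen U)
    (hne : (U ∩ {p | isSL2 p.1}).Nonempty) :
    5 ≤ dimH ({p : (Fin 2 → Fin 2 → ℝ) × (Fin 2 → ℝ) |
      isSL2 p.1 ∧ closure (affValSet p.1 p.2) ∩ B = ∅} ∩ U) := by
  obtain ⟨p, hpU, hp, hp0⟩ := exists_isSL2_add_ne_zero hU hne
  let U' := U ∩ {q | q.1 0 0 + q.1 1 0 ≠ 0}
  let S := {q : (Fin 2 → Fin 2 → ℝ) × (Fin 2 → ℝ) |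
    isSL2 q.1 ∧ closure (affValSet q.1 q.2) ∩ B = ∅}
  have hU' : IsOpen U' := hU.inter (isOpen_ne_fun (by fun_prop) continuous_const)
  -- a continuous choice of square root near the first coordinate sum of `p`
  obtain ⟨root, hroot, hrootp, hrootsq⟩ : ∃ root : ℝ → ℝ, Continuous root ∧
      root ((p.1 0 0 + p.1 1 0) ^ 2) = p.1 0 0 + p.1 1 0 ∧ ∀ σ, 0 < σ → root σ ^ 2 = σ := by
    rcases hp0.lt_or_gt with h | h
    · refine ⟨fun σ => -√σ, by fun_prop, ?_, fun σ hσ => ?_⟩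
      · simp only [Real.sqrt_sq_eq_abs, abs_of_neg h, neg_neg]
      · simp only [neg_sq, Real.sq_sqrt hσ.le]
    · refine ⟨fun σ => √σ, by fun_prop, ?_, fun σ hσ => ?_⟩
      · simp only [Real.sqrt_sq_eq_abs, abs_of_pos h]
      · simp only [Real.sq_sqrt hσ.le]
  have hcont : ContinuousAt (fun x : (Fin 4 → ℝ) × ℝ => ofChart x.1 (root x.2)) (toChart p) := by
    have hr : root (toChart p).2 ≠ 0 := by
      rw [show (toChart p).2 = (p.1 0 0 + p.1 1 0) ^ 2 from rfl, hrootp]; exact hp0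
    refine ContinuousAt.prodMk (continuousAt_pi.2 fun i => continuousAt_pi.2 fun j => ?_)
      (continuousAt_pi.2 fun i => ?_)
    · fin_cases i <;> fin_cases j <;> simp <;> fun_prop (disch := assumption)
    · fin_cases i <;> simp <;> fun_prop (disch := assumption)
  have hval : ofChart (toChart p).1 (root (toChart p).2) = p := by
    rw [show (toChart p).2 = (p.1 0 0 + p.1 1 0) ^ 2 from rfl, hrootp]
    exact ofChart_toChart hp hp0
  have hnhds : ∀ᶠ x in 𝓝 (toChart p), ofChart x.1 (root x.2) ∈ U' :=
    hcont.eventually (hU'.mem_nhds (by simp only [hval]; exact ⟨hpU, hp0⟩))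
  rw [show toChart p = ((toChart p).1, (toChart p).2) from rfl] at hnhds
  obtain ⟨V, hV, I, hI, hVI⟩ := mem_nhds_prod_iff.1 hnhds
  obtain ⟨ε, hε, hεI⟩ := Metric.mem_nhds_iff.1 hI
  have hσ0 : 0 < (toChart p).2 := sq_pos_of_ne_zero hp0
  have hslice : ∀ t ∈ V, 1 ≤ dimH {σ : ℝ | (t, σ) ∈ toChart '' (S ∩ U')} := by
    intro t ht
    refine (one_le_dimH_hypForm hB h0 (t 0) (t 2) (t 1) (t 3) hσ0 (half_pos hε)).trans
      (dimH_mono ?_)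
    rintro σ ⟨hσ, hσB⟩
    have hσpos : 0 < σ := hσ0.trans_le hσ.1
    have hr : root σ ≠ 0 := by
      intro h
      have := hrootsq σ hσpos
      rw [h] at this
      norm_num at this
      linarith
    have hσI : σ ∈ I := hεI (by
      rw [Metric.mem_ball, Real.dist_eq, abs_lt]
      constructor <;> linarith [hσ.1, hσ.2])
    refine ⟨ofChart t (root σ), ⟨⟨isSL2_ofChart t hr, ?_⟩, hVI (Set.mk_mem_prod ht hσI)⟩, ?_⟩
    · rw [affValSet_ofChart_eq t hr, hrootsq σ hσpos]
      refine Set.eq_empty_of_forall_notMem fun b hb => ?_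
      obtain ⟨η, hη, hlt⟩ := hσB b hb.2
      exact notMem_closure_of_lt_abs_sub hη hlt hb.1
    · rw [toChart_ofChart t hr, hrootsq σ hσpos]
  have hV0 : volume V ≠ 0 := (measure_pos_of_mem_nhds volume hV).ne'
  calc (5 : ENNReal) = ((4 : ℕ) : ENNReal) + 1 := by norm_num
    _ ≤ dimH (toChart '' (S ∩ U')) := le_dimH_of_slices _ V hV0 hslice
    _ ≤ dimH (S ∩ U') := dimH_image_le_of_contDiffAt fun q hq => by
        have hq0 : q.1 0 0 + q.1 1 0 ≠ 0 := hq.2.2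
        refine ContDiffAt.prodMk (contDiffAt_pi.2 fun i => ?_) ?_
        · fin_cases i <;> simp <;> fun_prop (disch := assumption)
        · fun_prop
    _ ≤ dimH (S ∩ U) := dimH_mono (Set.inter_subset_inter_right _ Set.inter_subset_left)

theorem stmt9 (B : Set ℝ) (hB : B.Countable) (h0 : (0 : ℝ) ∉ B) :
    ∀ U : Set ((Fin 2 → Fin 2 → ℝ) × (Fin 2 → ℝ)), IsOpen U →
      (U ∩ {p | isSL2 p.1}).Nonempty →
      dimH ({p : (Fin 2 → Fin 2 → ℝ) × (Fin 2 → ℝ) |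
          isSL2 p.1 ∧ closure (affValSet p.1 p.2) ∩ B = ∅} ∩ U) = 5 := by
  intro U hU hne
  refine le_antisymm ?_ (five_le_dimH_of_isOpen hB h0 hU hne)
  exact (dimH_mono fun p hp => hp.1.1).trans dimH_setOf_isSL2_le
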